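/- arXiv:2203.15850 — 9 statements merged into one kernel-verified Lean document; each statement's English description precedes it below -/
import Mathlib

section
/- Let $b > 0$, $c > 0$, and $a \le t$ be real numbers, and let $g : \mathbb{R} \to \mathbb{R}$ be continuous on $[a, t]$ with $|g(\tau)| \ge c$ for all $\tau \in [a, t]$. Then $\left| \int_{a}^{t} e^{-b(t-\tau)}\, g(\tau)\, d\tau \right| \ge \frac{c}{b}\left(1 - e^{-b(t-a)}\right)$. -/
theorem exp_weighted_aux
    (b c a t : ℝ) (hb : 0 < b) (hat : a ≤ t)
    (g : ℝ → ℝ) (hg : ContinuousOn g (Set.Icc a t))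
    (hlb : ∀ τ ∈ Set.Icc a t, c ≤ g τ) :
    c / b * (1 - Real.exp (-b * (t - a))) ≤
      ∫ τ in a..t, Real.exp (-b * (t - τ)) * g τ := by
  have h1 : ∫ τ in a..t, Real.exp (-b * (t - τ)) * c = c / b * (1 - Real.exp (-b * (t - a))) := by
    have hd : ∀ x ∈ Set.uIcc a t, HasDerivAt (fun τ => c / b * Real.exp (-b * (t - τ)))
        (Real.exp (-b * (t - x)) * c) x := by
      intro x _
      have h := ((((hasDerivAt_id x).const_sub t).const_mul (-b)).exp).const_mul (c / b)
      refine h.congr_deriv ?_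
      simp only [id]
      field_simp
    rw [intervalIntegral.integral_eq_sub_of_hasDerivAt hd
      (Continuous.intervalIntegrable (by fun_prop) _ _)]
    simp
    ring
  rw [← h1]
  apply intervalIntegral.integral_mono_on hat
  · exact Continuous.intervalIntegrable (by fun_prop) _ _
  · apply ContinuousOn.intervalIntegrable
    rw [Set.uIcc_of_le hat]
    exact ContinuousOn.mul (by fun_prop) hg
  · intro x hx
    exact mul_le_mul_of_nonneg_left (hlb x hx) (Real.exp_pos _).le

/-- Exponentially weighted integral lower bound for a continuous function
bounded away from zero in absolute value (Eq. (20) of the paper). -/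
theorem exp_weighted_integral_lower_bound
    (b c a t : ℝ) (hb : 0 < b) (hc : 0 < c) (hat : a ≤ t)
    (g : ℝ → ℝ) (hg : ContinuousOn g (Set.Icc a t))
    (hlb : ∀ τ ∈ Set.Icc a t, c ≤ |g τ|) :
    c / b * (1 - Real.exp (-b * (t - a))) ≤
      |∫ τ in a..t, Real.exp (-b * (t - τ)) * g τ| := by
  have hs : (∀ τ ∈ Set.Icc a t, c ≤ g τ) ∨ (∀ τ ∈ Set.Icc a t, c ≤ -g τ) := by
    by_contra! h
    obtain ⟨⟨x, hx, hx'⟩, ⟨y, hy, hy'⟩⟩ := h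
    have h1 : g x ≤ 0 := by
      rcases le_abs.1 (hlb x hx) with h | h <;> linarith
    have h2 : 0 ≤ g y := by
      rcases le_abs.1 (hlb y hy) with h | h <;> linarith
    obtain ⟨z, hz, hz0⟩ := isPreconnected_Icc.intermediate_value hx hy hg ⟨h1, h2⟩
    have := hlb z hz
    rw [hz0, abs_zero] at this
    linarith
  rcases hs with h | h
  · exact (exp_weighted_aux b c a t hb hat g hg h).trans (le_abs_self _)
  · have := exp_weighted_aux b c a t hb hat (fun τ => -g τ) hg.neg h
    simp only [mul_neg, intervalIntegral.integral_neg] at this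
    exact this.trans (neg_le_abs _)
end

section
/- Let $b > 0$, $\xi^* > 0$, and $\mu > 2\xi^*$, and let $a \le t_1$ be real numbers. Let $\varepsilon, \phi : \mathbb{R} \to \mathbb{R}$ be continuous on $[a, t_1]$ with $|\varepsilon(\tau)| < \xi^*$ and $|\phi(\tau)| \ge \mu$ for all $\tau \in [a, t_1]$. Suppose $\tilde{x}$ is differentiable on $[a, t_1]$ with $\tilde{x}'(t) = -b\,\tilde{x}(t) - \varepsilon(t) - \phi(t)$ there. If $|\tilde{x}(s)| \le \frac{3\mu - 2\xi^*}{4b}$ for all $s \in [a, t_1]$, then $t_1 - a \le \frac{1}{b}\ln\frac{7\mu - 6\xi^*}{\mu - 2\xi^*}$. -/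
theorem aux_bound
    (b ξ μ a t1 : ℝ) (hb : 0 < b) (hξ : 0 < ξ) (hμ : 2 * ξ < μ)
    (hat : a ≤ t1) (g x : ℝ → ℝ)
    (hg : ∀ τ ∈ Set.Icc a t1, g τ ≤ -(μ - ξ))
    (hx : ∀ t ∈ Set.Icc a t1, HasDerivAt x (-b * x t + g t) t)
    (hsmall : ∀ s ∈ Set.Icc a t1, |x s| ≤ (3 * μ - 2 * ξ) / (4 * b)) :
    t1 - a ≤ (1 / b) * Real.log ((7 * μ - 6 * ξ) / (μ - 2 * ξ)) := by
  have hd : ∀ t ∈ Set.Icc a t1, HasDerivAt (fun t => Real.exp (b * (t - a)) * (b * x t + (μ - ξ)))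
      (Real.exp (b * (t - a)) * b * (g t + (μ - ξ))) t := by
    intro t ht
    have h1 : HasDerivAt (fun t => Real.exp (b * (t - a))) (Real.exp (b * (t - a)) * (b * 1)) t :=
      (((hasDerivAt_id t).sub_const a).const_mul b).exp
    have h2 := h1.mul (((hx t ht).const_mul b).add_const (μ - ξ))
    refine h2.congr_deriv ?_
    ring
  have hanti : AntitoneOn (fun t => Real.exp (b * (t - a)) * (b * x t + (μ - ξ))) (Set.Icc a t1) := by
    apply antitoneOn_of_deriv_nonpos (convex_Icc a t1)
    · intro t ht
      exact (hd t ht).continuousAt.continuousWithinAt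
    · intro t ht
      exact (hd t (interior_subset ht)).differentiableAt.differentiableWithinAt
    · intro t ht
      rw [(hd t (interior_subset ht)).deriv]
      have := hg t (interior_subset ht)
      exact mul_nonpos_of_nonneg_of_nonpos (by positivity) (by linarith)
  have h := hanti (Set.left_mem_Icc.2 hat) (Set.right_mem_Icc.2 hat) hat
  simp only [sub_self, mul_zero, Real.exp_zero, one_mul] at h
  have ha := (abs_le.1 (hsmall a (Set.left_mem_Icc.2 hat))).2
  have ht := (abs_le.1 (hsmall t1 (Set.right_mem_Icc.2 hat))).1
  have e : b * ((3 * μ - 2 * ξ) / (4 * b)) = (3 * μ - 2 * ξ) / 4 := by field_simp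
  have ha' := mul_le_mul_of_nonneg_left ha hb.le
  have ht' := mul_le_mul_of_nonneg_left ht hb.le
  rw [mul_neg, e] at ht'
  rw [e] at ha'
  have hE := Real.exp_pos (b * (t1 - a))
  have h3 : Real.exp (b * (t1 - a)) * ((μ - 2 * ξ) / 4) ≤ (7 * μ - 6 * ξ) / 4 := by
    have := mul_le_mul_of_nonneg_left
      (show (μ - 2 * ξ) / 4 ≤ b * x t1 + (μ - ξ) by linarith) hE.le
    linarith
  have hp : 0 < μ - 2 * ξ := by linarith
  have h4 : Real.exp (b * (t1 - a)) ≤ (7 * μ - 6 * ξ) / (μ - 2 * ξ) := by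
    rw [le_div_iff₀ hp]; linarith
  have h5 := (Real.le_log_iff_exp_le (hE.trans_le h4)).2 h4
  rw [one_div, ← div_eq_inv_mul, le_div_iff₀ hb]
  linarith

/-- Bound on the length of a subinterval on which the faulty-mode
fault-detection residual `x' = -b x - ε - φ` can stay below the level
`(3μ - 2ξ*)/(4b)`, given `|ε| < ξ*` and `|φ| ≥ μ > 2ξ*`. -/
theorem small_residual_subinterval_length_bound
    (b ξstar μ a t1 : ℝ) (hb : 0 < b) (hξ : 0 < ξstar) (hμ : 2 * ξstar < μ)
    (hat : a ≤ t1)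
    (ε φ x : ℝ → ℝ)
    (hεc : ContinuousOn ε (Set.Icc a t1))
    (hφc : ContinuousOn φ (Set.Icc a t1))
    (hε : ∀ τ ∈ Set.Icc a t1, |ε τ| < ξstar)
    (hφ : ∀ τ ∈ Set.Icc a t1, μ ≤ |φ τ|)
    (hx : ∀ t ∈ Set.Icc a t1, HasDerivAt x (-b * x t - ε t - φ t) t)
    (hsmall : ∀ s ∈ Set.Icc a t1, |x s| ≤ (3 * μ - 2 * ξstar) / (4 * b)) :
    t1 - a ≤ (1 / b) * Real.log ((7 * μ - 6 * ξstar) / (μ - 2 * ξstar)) := by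
  have hsgn : (∀ t ∈ Set.Icc a t1, 0 < φ t) ∨ (∀ t ∈ Set.Icc a t1, φ t < 0) := by
    by_contra! hc
    obtain ⟨⟨s, hs, hs'⟩, ⟨t, ht, ht'⟩⟩ := hc
    obtain ⟨r, hr, hr'⟩ := isPreconnected_Icc.intermediate_value hs ht hφc ⟨hs', ht'⟩
    have := hφ r hr
    rw [hr', abs_zero] at this
    linarith
  rcases hsgn with h | h
  · refine aux_bound b ξstar μ a t1 hb hξ hμ hat (fun t => - ε t - φ t) x ?_ ?_ hsmall
    · intro t ht
      have h1 := hφ t ht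
      rw [abs_of_pos (h t ht)] at h1
      have h2 := abs_lt.1 (hε t ht)
      linarith [h2.1]
    · intro t ht
      exact (hx t ht).congr_deriv (by ring)
  · refine aux_bound b ξstar μ a t1 hb hξ hμ hat (fun t => ε t + φ t) (fun t => - x t) ?_ ?_ ?_
    · intro t ht
      have h1 := hφ t ht
      rw [abs_of_neg (h t ht)] at h1
      have h2 := abs_lt.1 (hε t ht)
      linarith [h2.2]
    · intro t ht
      exact (hx t ht).fun_neg.congr_deriv (by ring)
    · intro t ht
      simpa only [abs_neg] using hsmall t ht
end

section
/- Let $b > 0$, $L \ge 0$, and $c > bL$, and let $t_a \le t_b$ be real numbers. Let $h : \mathbb{R} \to \mathbb{R}$ be continuous on $[t_a, t_b]$ with $h(\tau) \ge c$ for all $\tau \in [t_a, t_b]$, and suppose $\tilde{x}$ is differentiable on $[t_a, t_b]$ with $\tilde{x}'(t) = -b\,\tilde{x}(t) + h(t)$ there. Then the set $\{ t \in [t_a, t_b] : |\tilde{x}(t)| \le L \}$ is order-convex (i.e., an interval): if $t_1 < t_2 < t_3$ are in $[t_a, t_b]$ with $|\tilde{x}(t_1)| \le L$ and $|\tilde{x}(t_3)|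 \le L$, then $|\tilde{x}(t_2)| \le L$. -/
/-- Under a one-signed forcing `h ≥ c > bL`, the sublevel set
`{t : |x t| ≤ L}` of the residual of `x' = -b x + h` is order-convex
(there is at most one subinterval of small residual magnitude). -/
theorem small_residual_set_order_convex
    (b L c ta tb : ℝ) (hb : 0 < b) (hL : 0 ≤ L) (hc : b * L < c) (htab : ta ≤ tb)
    (h x : ℝ → ℝ)
    (hhc : ContinuousOn h (Set.Icc ta tb))
    (hh : ∀ τ ∈ Set.Icc ta tb, c ≤ h τ)
    (hx : ∀ t ∈ Set.Icc ta tb, HasDerivAt x (-b * x t + h t) t) :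
    ∀ t1 t2 t3 : ℝ, t1 ∈ Set.Icc ta tb → t2 ∈ Set.Icc ta tb → t3 ∈ Set.Icc ta tb →
      t1 < t2 → t2 < t3 → |x t1| ≤ L → |x t3| ≤ L → |x t2| ≤ L := by
  have key : ∀ K s t : ℝ, b * K < c → s ∈ Set.Icc ta tb → t ∈ Set.Icc ta tb → s ≤ t →
      K ≤ x s → K ≤ x t := by
    intro K s t hK hs ht hst hKs
    have sub : ∀ u ∈ Set.Icc s t, u ∈ Set.Icc ta tb := fun u hu =>
      ⟨hs.1.trans hu.1, hu.2.trans ht.2⟩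
    refine image_le_of_deriv_right_lt_deriv_boundary' (f := fun _ => K) (f' := fun _ => 0)
      (B := x) (B' := fun u => -b * x u + h u) (a := s) (b := t) continuousOn_const
      (fun u _ => hasDerivWithinAt_const _ _ _) hKs
      (fun u hu => (hx u (sub u hu)).continuousAt.continuousWithinAt)
      (fun u hu => (hx u (sub u ⟨hu.1, hu.2.le⟩)).hasDerivWithinAt) ?_ ⟨hst, le_rfl⟩
    intro u hu he
    have h1 := hh u (sub u ⟨hu.1, hu.2.le⟩)
    have he' : K = x u := he
    show 0 < -b * x u + h u
    rw [← he']
    linarith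
  intro t1 t2 t3 m1 m2 m3 h12 h23 a1 a3
  rw [abs_le] at *
  refine ⟨key (-L) t1 t2 (by nlinarith) m1 m2 h12.le a1.1, ?_⟩
  by_contra hlt
  push Not at hlt
  have hLc : L < c / b := by rw [lt_div_iff₀ hb]; linarith
  obtain ⟨K, hK1, hK2⟩ := exists_between (lt_min hlt hLc)
  have hKc : K < c / b := hK2.trans_le (min_le_right _ _)
  rw [lt_div_iff₀ hb] at hKc
  have := key K t2 t3 (by linarith) m2 m3 h23.le (hK2.le.trans (min_le_left _ _))
  linarith [a3.2]
end

section
/- (Fault detectability, Theorem 2.) Let $b > 0$, $T > 0$, $\xi^* > 0$, $\varrho \ge 0$, and $\mu > 2\xi^* + 2\varrho$. Let $t_b - T \le t_a \le t_b$ be real numbers, and set $l := t_b - t_a$. Let $\varepsilon, \phi : \mathbb{R} \to \mathbb{R}$ be continuous on $[t_a, t_b]$ with $|\varepsilon(\tau)| < \xi^*$ and $|\phi(\tau)| \ge \mu$ for all $\tau \in [t_a, t_b]$. Let $\tilde{x} : \mathbb{R} \to \mathbb{R}$ be continuous on $[t_b - T, t_b]$, differentiable on $[t_a, t_b]$, and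 satisfy $\tilde{x}'(t) = -b\,\tilde{x}(t) - \varepsilon(t) - \phi(t)$ for $t \in [t_a, t_b]$. If $l \ge \frac{1}{b}\ln\frac{7\mu - 6\xi^*}{\mu - 2\xi^*} + \frac{T(4\xi^* + 4\varrho)}{3\mu - 2\xi^*}$, then $\frac{1}{T} \int_{t_b - T}^{t_b} |\tilde{x}(\tau)|\, d\tau > \frac{\xi^* + \varrho}{b}$, i.e., the $\mathcal{L}_1$ residual exceeds the fault-detection threshold $\bar{e}^0 = (\xi^* + \varrho)/b$ at time $t_b$ and the fault is detected. -/
theorem fd_aux (b m K S L ta tb : ℝ) (hb : 0 < b) (hK : 0 < K) (hm : b * K < m)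
    (hL0 : 0 < L) (hLe : Real.exp (b * L) * (m - b * K) = m + b * K)
    (h2 : ta ≤ tb) (y u : ℝ → ℝ)
    (hy : ∀ t ∈ Set.Icc ta tb, HasDerivAt y (-b * y t + u t) t)
    (hu : ∀ t ∈ Set.Icc ta tb, m ≤ u t)
    (hl : L + S ≤ tb - ta) :
    K * S < ∫ τ in ta..tb, |y τ| := by
  have hyc : ContinuousOn y (Set.Icc ta tb) :=
    fun t ht => (hy t ht).continuousAt.continuousWithinAt
  have hac : ContinuousOn (fun t => |y t|) (Set.Icc ta tb) := hyc.abs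
  have hanti : AntitoneOn (fun t => (m - b * y t) * Real.exp (b * t)) (Set.Icc ta tb) := by
    have hd : ∀ t ∈ Set.Icc ta tb, HasDerivAt (fun t => (m - b * y t) * Real.exp (b * t))
        ((-(b * (-b * y t + u t))) * Real.exp (b * t) +
          (m - b * y t) * (Real.exp (b * t) * (b * 1))) t := by
      intro t ht
      exact (((hy t ht).const_mul b).const_sub m).mul (((hasDerivAt_id t).const_mul b).exp)
    apply antitoneOn_of_deriv_nonpos (convex_Icc _ _)
    · exact fun t ht => (hd t ht).continuousAt.continuousWithinAt
    · intro t ht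
      rw [interior_Icc] at ht
      exact (hd t (Set.Ioo_subset_Icc_self ht)).differentiableAt.differentiableWithinAt
    · intro t ht
      rw [interior_Icc] at ht
      have ht' := Set.Ioo_subset_Icc_self ht
      rw [(hd t ht').deriv]
      have := hu t ht'
      have he := Real.exp_pos (b * t)
      have : 0 ≤ b * Real.exp (b * t) * (u t - m) :=
        mul_nonneg (by positivity) (by linarith)
      nlinarith
  have hii : ∀ p q, ta ≤ p → p ≤ q → q ≤ tb →
      IntervalIntegrable (fun t => |y t|) MeasureTheory.volume p q := by
    intro p q hp hpq hq
    apply ContinuousOn.intervalIntegrable_of_Icc hpq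
    exact hac.mono (Set.Icc_subset_Icc hp hq)
  have hge : ∀ p q, ta ≤ p → p ≤ q → q ≤ tb → (∀ t ∈ Set.Ioo p q, K ≤ |y t|) →
      K * (q - p) ≤ ∫ τ in p..q, |y τ| := by
    intro p q hp hpq hq h
    have := intervalIntegral.integral_mono_on_of_le_Ioo hpq
      (intervalIntegrable_const (c := K)) (hii p q hp hpq hq) h
    rw [intervalIntegral.integral_const, smul_eq_mul] at this
    linarith
  by_cases hne : (Set.Icc ta tb ∩ y ⁻¹' Set.Ici (-K)).Nonempty
  · have hcomp : IsCompact (Set.Icc ta tb ∩ y ⁻¹' Set.Ici (-K)) :=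
      isCompact_Icc.of_isClosed_subset (hyc.preimage_isClosed_of_isClosed isClosed_Icc isClosed_Ici)
        Set.inter_subset_left
    obtain ⟨s, ⟨hs, hsK⟩, hleast⟩ := hcomp.exists_isLeast hne
    have hsK' : -K ≤ y s := hsK
    have hI1 := hge ta s le_rfl hs.1 hs.2 (by
      intro t ht
      by_contra hc
      have h3 := (abs_lt.1 (not_le.1 hc)).1
      have := hleast ⟨⟨ht.1.le, ht.2.le.trans hs.2⟩, h3.le⟩
      exact absurd ht.2 (not_lt.2 this))
    have hsplit1 := intervalIntegral.integral_add_adjacent_intervals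
      (hii ta s le_rfl hs.1 hs.2) (hii s tb hs.1 hs.2 le_rfl)
    rcases lt_or_ge tb (s + L) with hcase | hcase
    · have hnn : 0 ≤ ∫ τ in s..tb, |y τ| :=
        intervalIntegral.integral_nonneg hs.2 (fun _ _ => abs_nonneg _)
      have : K * S < K * (s - ta) := mul_lt_mul_of_pos_left (by linarith) hK
      linarith
    · have hgood : ∀ t, s + L ≤ t → t ≤ tb → K ≤ y t := by
        intro t h3 h4
        have h5 := hanti hs ⟨by linarith [hs.1], h4⟩ (by linarith : s ≤ t)
        simp only at h5
        by_contra hc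
        have hc := not_le.1 hc
        have h6 : Real.exp (b * L) * Real.exp (b * s) ≤ Real.exp (b * t) := by
          rw [← Real.exp_add]; apply Real.exp_le_exp.2; nlinarith
        have h7 : (m - b * y s) * Real.exp (b * s) ≤ (m + b * K) * Real.exp (b * s) := by
          apply mul_le_mul_of_nonneg_right _ (Real.exp_pos _).le
          nlinarith
        have h8 : (m - b * K) * Real.exp (b * t) < (m - b * y t) * Real.exp (b * t) := by
          apply mul_lt_mul_of_pos_right _ (Real.exp_pos _)
          nlinarith
        have h9 : (m - b * K) * (Real.exp (b * L) * Real.exp (b * s)) ≤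
            (m - b * K) * Real.exp (b * t) := mul_le_mul_of_nonneg_left h6 (by linarith)
        have h10 : (m - b * K) * (Real.exp (b * L) * Real.exp (b * s)) =
          (m + b * K) * Real.exp (b * s) := by rw [← hLe]; ring
        linarith
      have hI3 := hge (s + L) tb (by linarith [hs.1]) hcase le_rfl
        (fun t ht => (hgood t ht.1.le ht.2.le).trans (le_abs_self _))
      have hI2 : 0 < ∫ τ in s..(s+L), |y τ| := by
        apply intervalIntegral.integral_pos (by linarith)
          (hac.mono (Set.Icc_subset_Icc hs.1 hcase)) (fun _ _ => abs_nonneg _)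
        exact ⟨s + L, ⟨by linarith, le_rfl⟩,
          lt_of_lt_of_le hK ((hgood _ le_rfl hcase).trans (le_abs_self _))⟩
      have hsplit2 := intervalIntegral.integral_add_adjacent_intervals
        (hii s (s+L) hs.1 (by linarith) hcase) (hii (s+L) tb (by linarith [hs.1]) hcase le_rfl)
      have : K * S ≤ K * (s - ta) + K * (tb - (s + L)) := by
        rw [← mul_add]; exact mul_le_mul_of_nonneg_left (by linarith) hK.le
      linarith
  · have := hge ta tb le_rfl h2 le_rfl (by
      intro t ht
      by_contra hc
      have h3 := (abs_lt.1 (not_le.1 hc)).1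
      exact hne ⟨t, ⟨ht.1.le, ht.2.le⟩, h3.le⟩)
    have : K * S < K * (tb - ta) := mul_lt_mul_of_pos_left (by linarith) hK
    linarith

/-- Fault detectability (Theorem 2 of the paper): if the fault `φ` has
magnitude at least `μ > 2ξ* + 2ϱ` on an interval `[t_a, t_b] ⊆ [t_b - T, t_b]`
of length `l = t_b - t_a` at least
`(1/b) ln((7μ - 6ξ*)/(μ - 2ξ*)) + T(4ξ* + 4ϱ)/(3μ - 2ξ*)`, then the windowed
`L¹` residual of `x' = -b x - ε - φ` exceeds the detection threshold
`(ξ* + ϱ)/b` at time `t_b`. -/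
theorem fault_detectability
    (b T ξstar ϱ μ ta tb : ℝ)
    (hb : 0 < b) (hT : 0 < T) (hξ : 0 < ξstar) (hϱ : 0 ≤ ϱ)
    (hμ : 2 * ξstar + 2 * ϱ < μ)
    (h1 : tb - T ≤ ta) (h2 : ta ≤ tb)
    (ε φ x : ℝ → ℝ)
    (hεc : ContinuousOn ε (Set.Icc ta tb))
    (hφc : ContinuousOn φ (Set.Icc ta tb))
    (hε : ∀ τ ∈ Set.Icc ta tb, |ε τ| < ξstar)
    (hφ : ∀ τ ∈ Set.Icc ta tb, μ ≤ |φ τ|)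
    (hxc : ContinuousOn x (Set.Icc (tb - T) tb))
    (hx : ∀ t ∈ Set.Icc ta tb, HasDerivAt x (-b * x t - ε t - φ t) t)
    (hl : (1 / b) * Real.log ((7 * μ - 6 * ξstar) / (μ - 2 * ξstar)) +
        T * (4 * ξstar + 4 * ϱ) / (3 * μ - 2 * ξstar) ≤ tb - ta) :
    (ξstar + ϱ) / b < (1 / T) * (∫ τ in (tb - T)..tb, |x τ|) := by
  have hm0 : 0 < μ - 2 * ξstar := by linarith
  have hR : 1 < (7 * μ - 6 * ξstar) / (μ - 2 * ξstar) := by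
    rw [lt_div_iff₀ hm0]; linarith
  have hD : 0 < 3 * μ - 2 * ξstar := by linarith
  set L := (1 / b) * Real.log ((7 * μ - 6 * ξstar) / (μ - 2 * ξstar)) with hL
  have hL0 : 0 < L := mul_pos (by positivity) (Real.log_pos hR)
  have hbL : b * L = Real.log ((7 * μ - 6 * ξstar) / (μ - 2 * ξstar)) := by
    rw [hL]; field_simp
  have hbK : b * ((3 * μ - 2 * ξstar) / (4 * b)) = (3 * μ - 2 * ξstar) / 4 := by
    field_simp
  have hLe : Real.exp (b * L) * ((μ - ξstar) - b * ((3 * μ - 2 * ξstar) / (4 * b))) =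
      (μ - ξstar) + b * ((3 * μ - 2 * ξstar) / (4 * b)) := by
    rw [hbL, Real.exp_log (by linarith), hbK]
    rw [div_mul_eq_mul_div, div_eq_iff hm0.ne']
    ring
  have key : (3 * μ - 2 * ξstar) / (4 * b) * (T * (4 * ξstar + 4 * ϱ) / (3 * μ - 2 * ξstar)) <
      ∫ τ in ta..tb, |x τ| := by
    have hsgn : (∀ t ∈ Set.Icc ta tb, μ ≤ φ t) ∨ (∀ t ∈ Set.Icc ta tb, μ ≤ -φ t) := by
      by_contra hc
      push Not at hc
      obtain ⟨⟨p, hp, hp'⟩, ⟨q, hq, hq'⟩⟩ := hc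
      have hp2 : φ p ≤ 0 := by
        by_contra h
        have := hφ p hp
        rw [abs_of_pos (not_le.1 h)] at this
        linarith
      have hq2 : 0 ≤ φ q := by
        by_contra h
        have := hφ q hq
        rw [abs_of_neg (not_le.1 h)] at this
        linarith
      obtain ⟨r, hr, hr0⟩ := isPreconnected_Icc.intermediate_value hp hq hφc ⟨hp2, hq2⟩
      have := hφ r hr
      rw [hr0, abs_zero] at this
      linarith
    rcases hsgn with hs | hs
    · have := fd_aux b (μ - ξstar) _ _ L ta tb hb (by positivity) (by rw [hbK]; linarith) hL0 hLe h2
        (fun t => - x t) (fun t => ε t + φ t)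
        (fun t ht => by
          have h := (hx t ht).neg
          exact h.congr_deriv (by ring))
        (fun t ht => by
          have := (abs_lt.1 (hε t ht)).1
          have := hs t ht
          linarith) hl
      simpa only [abs_neg] using this
    · exact fd_aux b (μ - ξstar) _ _ L ta tb hb (by positivity) (by rw [hbK]; linarith) hL0 hLe h2
        x (fun t => - ε t - φ t)
        (fun t ht => by
          have := hx t ht
          convert this using 1
          ring)
        (fun t ht => by
          have := (abs_lt.1 (hε t ht)).2
          have := hs t ht
          linarith) hl
  have hac : ContinuousOn (fun t => |x t|) (Set.Icc (tb - T) tb) := hxc.abs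
  have hsplit := intervalIntegral.integral_add_adjacent_intervals
    ((hac.mono (Set.Icc_subset_Icc le_rfl h2)).intervalIntegrable_of_Icc
      (μ := MeasureTheory.volume) h1)
    ((hac.mono (Set.Icc_subset_Icc h1 le_rfl)).intervalIntegrable_of_Icc h2)
  have hnn : 0 ≤ ∫ τ in (tb - T)..ta, |x τ| :=
    intervalIntegral.integral_nonneg h1 (fun _ _ => abs_nonneg _)
  have heq : (3 * μ - 2 * ξstar) / (4 * b) * (T * (4 * ξstar + 4 * ϱ) / (3 * μ - 2 * ξstar)) =
      T * ((ξstar + ϱ) / b) := by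
    field_simp
  rw [heq] at key
  rw [one_div, ← div_eq_inv_mul, lt_div_iff₀ hT]
  linarith
end

section
/- Let $b > 0$ and $\xi^* > 0$, let $t_d$ be a real number, and let $\varepsilon, \rho, \bar{\rho} : \mathbb{R} \to \mathbb{R}$ be continuous on $[t_d, \infty)$ with $|\varepsilon(\tau)| < \xi^*$ and $|\rho(\tau)| \le \bar{\rho}(\tau)$ for all $\tau \ge t_d$. Suppose $\tilde{x}$ is differentiable on $[t_d, \infty)$ with $\tilde{x}(t_d) = 0$ and $\tilde{x}'(t) = -b\,\tilde{x}(t) - \varepsilon(t) + \rho(t)$ for $t \ge t_d$. Then: (a) for all $t \ge t_d$, $|\tilde{x}(t)| < \frac{\xi^*}{b} + \int_{t_d}^{t} e^{-b(t-\tau)}\, \bar{\rho}(\tau)\, d\tau$; and (b) for every $T > 0$ and every $t \ge t_d + T$, $\frac{1}{T}\int_{t-T}^{t} |\tilde{x}(s)|\, ds < \frac{\xi^*}{b} + \frac{1}{T}\int_{t-T}^{t}\left( \int_{t_d}^{s} e^{-b(s-\tau)}\, \bar{\rho}(\tau)\, d\tau \right) ds$, i.e., the matched fault-isolation residual never exceeds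 the adaptive threshold $\bar{e}^l(t)$. -/
/-- The matched fault-isolation residual `x' = -b x - ε + ρ`, `x t_d = 0`, with
`|ε| < ξ*` and `|ρ| ≤ ρ̄`, never exceeds the adaptive threshold built from the
kernel `ξ*/b + ∫_{t_d}^t e^{-b(t-τ)} ρ̄(τ) dτ`. -/
theorem matched_residual_below_adaptive_threshold
    (b ξstar td : ℝ) (hb : 0 < b) (hξ : 0 < ξstar)
    (ε ρ ρbar x : ℝ → ℝ)
    (hεc : ContinuousOn ε (Set.Ici td))
    (hρc : ContinuousOn ρ (Set.Ici td))
    (hρbc : ContinuousOn ρbar (Set.Ici td))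
    (hε : ∀ τ : ℝ, td ≤ τ → |ε τ| < ξstar)
    (hρ : ∀ τ : ℝ, td ≤ τ → |ρ τ| ≤ ρbar τ)
    (hx0 : x td = 0)
    (hx : ∀ t : ℝ, td ≤ t → HasDerivAt x (-b * x t - ε t + ρ t) t) :
    (∀ t : ℝ, td ≤ t →
      |x t| < ξstar / b + ∫ τ in td..t, Real.exp (-b * (t - τ)) * ρbar τ) ∧
    (∀ T t : ℝ, 0 < T → td + T ≤ t →
      (1 / T) * (∫ s in (t - T)..t, |x s|) <
        ξstar / b +
          (1 / T) * (∫ s in (t - T)..t, ∫ τ in td..s, Real.exp (-b * (s - τ)) * ρbar τ)) := by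
  have hsub : ∀ t, td ≤ t → Set.uIcc td t ⊆ Set.Ici td := by
    intro t ht y hy
    rw [Set.uIcc_of_le ht] at hy
    exact hy.1
  have hexp : Continuous (fun τ : ℝ => Real.exp (b * τ)) := by fun_prop
  have hG : ∀ s, (∫ τ in td..s, Real.exp (-b * (s - τ)) * ρbar τ)
      = Real.exp (-b * s) * ∫ τ in td..s, Real.exp (b * τ) * ρbar τ := by
    intro s
    rw [← intervalIntegral.integral_const_mul]
    congr 1
    funext τ
    rw [← mul_assoc, ← Real.exp_add]
    congr 2
    ring
  have hint : ∀ t, td ≤ t → IntervalIntegrable (fun τ => Real.exp (b * τ) * ρbar τ)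
      MeasureTheory.volume td t := fun t ht =>
    (hexp.continuousOn.mul (hρbc.mono (hsub t ht))).intervalIntegrable
  have ha : ∀ t : ℝ, td ≤ t →
      |x t| < ξstar / b + ∫ τ in td..t, Real.exp (-b * (t - τ)) * ρbar τ := by
    intro t ht
    have hF : ∀ s, HasDerivAt (fun s => Real.exp (b * s)) (Real.exp (b * s) * b) s := by
      intro s
      simpa using ((hasDerivAt_id s).const_mul b).exp
    have hi1 : IntervalIntegrable (fun τ => Real.exp (b * τ) * (-ε τ + ρ τ))
        MeasureTheory.volume td t :=
      (hexp.continuousOn.mul (((hεc.mono (hsub t ht)).neg).add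
        (hρc.mono (hsub t ht)))).intervalIntegrable
    have h1 : (∫ τ in td..t, Real.exp (b * τ) * (-ε τ + ρ τ)) = Real.exp (b * t) * x t := by
      rw [intervalIntegral.integral_eq_sub_of_hasDerivAt
        (f := fun s => Real.exp (b * s) * x s) _ hi1]
      · simp [hx0]
      · intro s hs
        refine ((hF s).mul (hx s (hsub t ht hs))).congr_deriv ?_
        ring
    have hi2 : IntervalIntegrable (fun τ => Real.exp (b * τ) * ξstar)
        MeasureTheory.volume td t := (hexp.mul continuous_const).intervalIntegrable _ _
    have h2 : (∫ τ in td..t, Real.exp (b * τ) * ξstar)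
        = Real.exp (b * t) * (ξstar / b) - Real.exp (b * td) * (ξstar / b) := by
      rw [intervalIntegral.integral_eq_sub_of_hasDerivAt
        (f := fun s => Real.exp (b * s) * (ξstar / b)) _ hi2]
      intro s _
      refine ((hF s).mul_const (ξstar / b)).congr_deriv ?_
      field_simp
    have h3 : |∫ τ in td..t, Real.exp (b * τ) * (-ε τ + ρ τ)| ≤
        ∫ τ in td..t, (Real.exp (b * τ) * ξstar + Real.exp (b * τ) * ρbar τ) := by
      refine (intervalIntegral.abs_integral_le_integral_abs ht).trans ?_
      refine intervalIntegral.integral_mono_on ht hi1.abs (hi2.add (hint t ht)) ?_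
      intro s hs
      rw [abs_mul, abs_of_pos (Real.exp_pos _), ← mul_add]
      refine mul_le_mul_of_nonneg_left ?_ (Real.exp_pos _).le
      refine (abs_add_le _ _).trans ?_
      rw [abs_neg]
      exact add_le_add (hε s hs.1).le (hρ s hs.1)
    rw [intervalIntegral.integral_add hi2 (hint t ht), h1, h2, abs_mul,
      abs_of_pos (Real.exp_pos _)] at h3
    rw [hG]
    have hp : 0 < Real.exp (b * td) * (ξstar / b) := by positivity
    have he : Real.exp (b * t) * Real.exp (-b * t) = 1 := by
      rw [← Real.exp_add]; simp
    refine lt_of_mul_lt_mul_left ?_ (Real.exp_pos (b * t)).le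
    rw [mul_add, ← mul_assoc (Real.exp (b * t)) (Real.exp (-b * t)), he]
    linarith
  refine ⟨ha, ?_⟩
  intro T t hT ht
  have hlt : t - T < t := by linarith
  have hIcc : Set.Icc (t - T) t ⊆ Set.uIcc td t := by
    rw [Set.uIcc_of_le (by linarith)]
    exact Set.Icc_subset_Icc_left (by linarith)
  have hxc : ContinuousOn (fun s => |x s|) (Set.Icc (t - T) t) := by
    intro s hs
    exact (hx s (by linarith [hs.1])).continuousAt.abs.continuousWithinAt
  have hgc : ContinuousOn (fun s => ∫ τ in td..s, Real.exp (-b * (s - τ)) * ρbar τ)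
      (Set.Icc (t - T) t) := by
    simp_rw [hG]
    refine ContinuousOn.mul (by fun_prop) ?_
    refine ContinuousOn.mono ?_ hIcc
    refine intervalIntegral.continuousOn_primitive_interval ?_
    have := hexp.continuousOn.mul (hρbc.mono (hsub t (by linarith)))
    exact this.integrableOn_compact isCompact_uIcc
  have key := intervalIntegral.integral_lt_integral_of_continuousOn_of_le_of_exists_lt hlt hxc
    (continuousOn_const.add hgc : ContinuousOn (fun s => ξstar / b +
      ∫ τ in td..s, Real.exp (-b * (s - τ)) * ρbar τ) _)
    (fun s hs => (ha s (by linarith [hs.1])).le)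
    ⟨t, Set.right_mem_Icc.2 hlt.le, ha t (by linarith)⟩
  simp only [Pi.add_apply] at key
  rw [intervalIntegral.integral_add (by simp)
    (hgc.intervalIntegrable_of_Icc hlt.le), intervalIntegral.integral_const] at key
  have := mul_lt_mul_of_pos_left key (one_div_pos.2 hT)
  refine this.trans_eq ?_
  rw [mul_add, smul_eq_mul]
  congr 1
  field_simp
  ring
end

section
/- Let $b > 0$, $\xi^* > 0$, $\bar{\rho}_{\max} \ge 0$, $\mu > 2\xi^*$, and real numbers $t_d \le a \le t_1$. Let $\varepsilon, \rho, \bar{\rho} : \mathbb{R} \to \mathbb{R}$ be continuous on $[t_d, t_1]$ with $|\varepsilon(\tau)| < \xi^*$ and $0 \le \bar{\rho}(\tau) \le \bar{\rho}_{\max}$ on $[t_d, t_1]$, and $|\rho(\tau)| - \bar{\rho}(\tau) \ge \mu$ for all $\tau \in [a, t_1]$. Define $\vartheta(t) := \frac{\xi^*}{b} + \int_{t_d}^{t} e^{-b(t-\tau)}\, \bar{\rho}(\tau)\, d\tau$. Suppose $\tilde{x}$ is differentiable on $[a, t_1]$ with $\tilde{x}'(t) = -b\,\tilde{x}(t) -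 \varepsilon(t) + \rho(t)$ there. If $|\tilde{x}(s)| - \vartheta(s) \le \frac{\mu - 2\xi^*}{2b}$ for all $s \in [a, t_1]$, then $t_1 - a \le \frac{1}{b}\ln\frac{3\mu + 4\bar{\rho}_{\max}}{\mu - 2\xi^*}$. -/
theorem key_pos
    (b ξstar ρmax μ td a t1 : ℝ)
    (hb : 0 < b) (hξ : 0 < ξstar) (hρmax : 0 ≤ ρmax) (hμ : 2 * ξstar < μ)
    (h1 : td ≤ a) (h2 : a ≤ t1)
    (ε ρ ρbar x : ℝ → ℝ)
    (hρbc : ContinuousOn ρbar (Set.Icc td t1))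
    (hε : ∀ τ ∈ Set.Icc td t1, |ε τ| < ξstar)
    (hρb : ∀ τ ∈ Set.Icc td t1, 0 ≤ ρbar τ ∧ ρbar τ ≤ ρmax)
    (hgap : ∀ τ ∈ Set.Icc a t1, μ ≤ ρ τ - ρbar τ)
    (hx : ∀ t ∈ Set.Icc a t1, HasDerivAt x (-b * x t - ε t + ρ t) t)
    (hsmall : ∀ s ∈ Set.Icc a t1,
      |x s| - (ξstar / b + ∫ τ in td..s, Real.exp (-b * (s - τ)) * ρbar τ) ≤
        (μ - 2 * ξstar) / (2 * b)) :
    t1 - a ≤ (1 / b) * Real.log ((3 * μ + 4 * ρmax) / (μ - 2 * ξstar)) := by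
  have h3 : td ≤ t1 := h1.trans h2
  obtain ⟨g, hgc, hg⟩ : ∃ g : ℝ → ℝ, Continuous g ∧ ∀ t ∈ Set.Icc td t1, g t = ρbar t := by
    refine ⟨Set.IccExtend h3 ((Set.Icc td t1).domRestrict ρbar), ?_, ?_⟩
    · exact (continuousOn_iff_continuous_domRestrict.mp hρbc).Icc_extend'
    · intro t ht
      rw [Set.IccExtend_of_mem h3 _ ht]; rfl
  have hfc : Continuous (fun τ => Real.exp (b * τ) * g τ) := by fun_prop
  set J : ℝ → ℝ := fun s => ∫ τ in td..s, Real.exp (b * τ) * g τ with hJ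
  have hJd : ∀ s, HasDerivAt J (Real.exp (b * s) * g s) s := fun s =>
    intervalIntegral.integral_hasDerivAt_right (hfc.intervalIntegrable _ _)
      hfc.stronglyMeasurable.stronglyMeasurableAtFilter hfc.continuousAt
  have hIJ : ∀ s ∈ Set.Icc td t1, (∫ τ in td..s, Real.exp (-b * (s - τ)) * ρbar τ)
      = Real.exp (-(b * s)) * J s := by
    intro s hs
    rw [hJ, ← intervalIntegral.integral_const_mul]
    apply intervalIntegral.integral_congr
    intro τ hτ
    rw [Set.uIcc_of_le hs.1] at hτ
    simp only
    rw [hg τ ⟨hτ.1, hτ.2.trans hs.2⟩, ← mul_assoc, ← Real.exp_add]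
    congr 2; ring
  have hE : ∀ s, HasDerivAt (fun s => Real.exp (b * s)) (Real.exp (b * s) * b) s := by
    intro s
    simpa using ((hasDerivAt_id s).const_mul b).exp
  -- bound on J a
  have hJa : J a ≤ ρmax / b * Real.exp (b * a) := by
    have hd : ∀ s, HasDerivAt (fun s => ρmax / b * Real.exp (b * s) - J s)
        (ρmax / b * (Real.exp (b * s) * b) - Real.exp (b * s) * g s) s :=
      fun s => ((hE s).const_mul _).sub (hJd s)
    have hm : MonotoneOn (fun s => ρmax / b * Real.exp (b * s) - J s) (Set.Icc td t1) := by
      apply monotoneOn_of_deriv_nonneg (convex_Icc _ _)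
      · exact fun s _ => (hd s).continuousAt.continuousWithinAt
      · exact fun s _ => (hd s).differentiableAt.differentiableWithinAt
      · intro s hs
        have hs := interior_subset hs
        rw [(hd s).deriv, hg s hs]
        have : ρmax / b * (Real.exp (b * s) * b) - Real.exp (b * s) * ρbar s
          = Real.exp (b * s) * (ρmax - ρbar s) := by field_simp
        rw [this]
        exact mul_nonneg (Real.exp_pos _).le (by linarith [(hρb s hs).2])
    have := hm ⟨le_rfl, h3⟩ ⟨h1, h2⟩ h1
    have h0 : J td = 0 := by simp [hJ]
    have h4 : 0 ≤ ρmax / b * Real.exp (b * td) := by positivity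
    simp only [h0] at this
    linarith
  have hW : Real.exp (b * a) * x a - J a - (μ - ξstar) / b * Real.exp (b * a) ≤
      Real.exp (b * t1) * x t1 - J t1 - (μ - ξstar) / b * Real.exp (b * t1) := by
    have hd : ∀ s ∈ Set.Icc a t1, HasDerivAt
        (fun s => Real.exp (b * s) * x s - J s - (μ - ξstar) / b * Real.exp (b * s)) 
        (Real.exp (b * s) * b * x s + Real.exp (b * s) * (-b * x s - ε s + ρ s)
          - Real.exp (b * s) * g s - (μ - ξstar) / b * (Real.exp (b * s) * b)) s :=
      fun s hs => (((hE s).mul (hx s hs)).sub (hJd s)).sub ((hE s).const_mul _)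
    have hm : MonotoneOn (fun s => Real.exp (b * s) * x s - J s
        - (μ - ξstar) / b * Real.exp (b * s)) (Set.Icc a t1) := by
      apply monotoneOn_of_deriv_nonneg (convex_Icc _ _)
      · exact fun s hs => (hd s hs).continuousAt.continuousWithinAt
      · exact fun s hs => (hd s (interior_subset hs)).differentiableAt.differentiableWithinAt
      · intro s hs
        have hs := interior_subset hs
        have hs' : s ∈ Set.Icc td t1 := ⟨h1.trans hs.1, hs.2⟩
        rw [(hd s hs).deriv, hg s hs']
        have : Real.exp (b * s) * b * x s + Real.exp (b * s) * (-b * x s - ε s + ρ s)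
          - Real.exp (b * s) * ρbar s - (μ - ξstar) / b * (Real.exp (b * s) * b)
          = Real.exp (b * s) * ((ρ s - ρbar s - μ) + (ξstar - ε s)) := by
          field_simp; ring
        rw [this]
        exact mul_nonneg (Real.exp_pos _).le
          (by linarith [hgap s hs, (abs_lt.mp (hε s hs')).2])
    exact hm ⟨le_rfl, h2⟩ ⟨h2, le_rfl⟩ h2
  have hS : ∀ s ∈ Set.Icc a t1, Real.exp (b * s) * |x s| - J s ≤ μ / (2 * b) * Real.exp (b * s) := by
    intro s hs
    have h := hsmall s hs
    rw [hIJ s ⟨h1.trans hs.1, hs.2⟩] at h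
    have h5 : |x s| - Real.exp (-(b * s)) * J s ≤ μ / (2 * b) := by
      have : (μ - 2 * ξstar) / (2 * b) + ξstar / b = μ / (2 * b) := by field_simp; ring
      linarith
    have h6 := mul_le_mul_of_nonneg_right h5 (Real.exp_pos (b * s)).le
    have h7 : Real.exp (-(b * s)) * Real.exp (b * s) = 1 := by rw [← Real.exp_add]; simp
    linear_combination h6 + J s * h7
  have hA := hS a ⟨le_rfl, h2⟩
  have hB := hS t1 ⟨h2, le_rfl⟩
  have hxa := mul_le_mul_of_nonneg_left (neg_abs_le (x a)) (Real.exp_pos (b * a)).le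
  have hxb := mul_le_mul_of_nonneg_left (le_abs_self (x t1)) (Real.exp_pos (b * t1)).le
  have hpos : 0 < μ - 2 * ξstar := by linarith
  have hea := Real.exp_pos (b * a)
  have hfin : (μ - 2 * ξstar) * Real.exp (b * t1) ≤ (3 * μ + 4 * ρmax) * Real.exp (b * a) := by
    have : (μ - ξstar) / b * Real.exp (b * t1) - μ / (2 * b) * Real.exp (b * t1) ≤
      (μ - ξstar) / b * Real.exp (b * a) + μ / (2 * b) * Real.exp (b * a)
        + 2 * (ρmax / b * Real.exp (b * a)) := by linarith
    have h8 := mul_le_mul_of_nonneg_left this (by positivity : 0 ≤ 2 * b)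
    field_simp at h8
    nlinarith [mul_pos hξ hea]
  have hlog : b * (t1 - a) ≤ Real.log ((3 * μ + 4 * ρmax) / (μ - 2 * ξstar)) := by
    rw [Real.le_log_iff_exp_le (div_pos (by linarith) hpos), le_div_iff₀ hpos, mul_sub b,
      Real.exp_sub, div_mul_eq_mul_div, div_le_iff₀ hea]
    linarith
  rw [one_div, ← div_eq_inv_mul, le_div_iff₀ hb]
  linarith


/-- Bound on the length of the subinterval `I₁ᵏ` (Eq. (32) of the paper) on
which the mismatched fault-isolation residual `x' = -b x - ε + ρ` can keep
`|x| - ϑ` below the level `(μ - 2ξ*)/(2b)`, where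
`ϑ(t) = ξ*/b + ∫_{t_d}^t e^{-b(t-τ)} ρ̄(τ) dτ` is the adaptive-threshold
kernel. -/
theorem mismatched_residual_minus_kernel_subinterval_length_bound
    (b ξstar ρmax μ td a t1 : ℝ)
    (hb : 0 < b) (hξ : 0 < ξstar) (hρmax : 0 ≤ ρmax) (hμ : 2 * ξstar < μ)
    (h1 : td ≤ a) (h2 : a ≤ t1)
    (ε ρ ρbar x : ℝ → ℝ)
    (hεc : ContinuousOn ε (Set.Icc td t1))
    (hρc : ContinuousOn ρ (Set.Icc td t1))
    (hρbc : ContinuousOn ρbar (Set.Icc td t1))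
    (hε : ∀ τ ∈ Set.Icc td t1, |ε τ| < ξstar)
    (hρb : ∀ τ ∈ Set.Icc td t1, 0 ≤ ρbar τ ∧ ρbar τ ≤ ρmax)
    (hgap : ∀ τ ∈ Set.Icc a t1, μ ≤ |ρ τ| - ρbar τ)
    (hx : ∀ t ∈ Set.Icc a t1, HasDerivAt x (-b * x t - ε t + ρ t) t)
    (hsmall : ∀ s ∈ Set.Icc a t1,
      |x s| - (ξstar / b + ∫ τ in td..s, Real.exp (-b * (s - τ)) * ρbar τ) ≤
        (μ - 2 * ξstar) / (2 * b)) :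
    t1 - a ≤ (1 / b) * Real.log ((3 * μ + 4 * ρmax) / (μ - 2 * ξstar)) := by


  have hsub : Set.Icc a t1 ⊆ Set.Icc td t1 := Set.Icc_subset_Icc_left h1
  have habs : ∀ τ ∈ Set.Icc a t1, 0 < |ρ τ| := fun τ hτ => by
    linarith [hgap τ hτ, (hρb τ (hsub hτ)).1]
  have hρc' := hρc.mono hsub
  have ha : a ∈ Set.Icc a t1 := ⟨le_rfl, h2⟩
  have hsign : (∀ τ ∈ Set.Icc a t1, 0 ≤ ρ τ) ∨ (∀ τ ∈ Set.Icc a t1, ρ τ ≤ 0) := by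
    by_contra hcon
    push Not at hcon
    obtain ⟨⟨p, hp, hp'⟩, ⟨q, hq, hq'⟩⟩ := hcon
    obtain ⟨z, hz, hz'⟩ := isPreconnected_Icc.intermediate_value hp hq hρc' ⟨hp'.le, hq'.le⟩
    have := habs z hz
    rw [hz'] at this
    simp at this
  rcases hsign with hs | hs
  · refine key_pos b ξstar ρmax μ td a t1 hb hξ hρmax hμ h1 h2 ε ρ ρbar x hρbc hε hρb ?_ hx hsmall
    intro τ hτ
    have := hgap τ hτ
    rwa [abs_of_nonneg (hs τ hτ)] at this
  · refine key_pos b ξstar ρmax μ td a t1 hb hξ hρmax hμ h1 h2 (fun t => -ε t) (fun t => -ρ t)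
      ρbar (fun t => -x t) hρbc ?_ hρb ?_ ?_ ?_
    · intro τ hτ
      simpa using hε τ hτ
    · intro τ hτ
      have := hgap τ hτ
      rwa [abs_of_nonpos (hs τ hτ)] at this
    · intro t ht
      have := (hx t ht).fun_neg
      refine this.congr_deriv ?_
      ring
    · intro s hs
      simpa only [abs_neg] using hsmall s hs
end

section
/- Let $b > 0$, $\xi^* > 0$, $\bar{\rho}_{\max} \ge 0$, $\mu > 2\xi^*$, and real numbers $t_d \le a \le t_1$. Let $\varepsilon, \rho, \bar{\rho} : \mathbb{R} \to \mathbb{R}$ be continuous on $[t_d, t_1]$ with $|\varepsilon(\tau)| < \xi^*$ and $0 \le \bar{\rho}(\tau) \le \bar{\rho}_{\max}$ on $[t_d, t_1]$, and $|\rho(\tau)| - \bar{\rho}(\tau) \ge \mu$ for all $\tau \in [a, t_1]$. Define $\vartheta(t) := \frac{\xi^*}{b} + \int_{t_d}^{t} e^{-b(t-\tau)}\, \bar{\rho}(\tau)\, d\tau$. Suppose $\tilde{x}$ is differentiable on $[a, t_1]$ with $\tilde{x}'(t) = -b\,\tilde{x}(t) - \varepsilon(t) + \rho(t)$ there. If $|\tilde{x}(s)|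 \le \vartheta(s)$ for all $s \in [a, t_1]$, then $t_1 - a \le \frac{1}{b}\ln\frac{\mu + 2\bar{\rho}_{\max} + \xi^*}{\mu - 2\xi^*}$. -/
theorem aux_pos
    (b ξstar ρmax μ td a t1 : ℝ)
    (hb : 0 < b) (hξ : 0 < ξstar) (hρmax : 0 ≤ ρmax) (hμ : 2 * ξstar < μ)
    (h1 : td ≤ a) (h2 : a ≤ t1)
    (ε ρ ρbar x : ℝ → ℝ)
    (hρbc : ContinuousOn ρbar (Set.Icc td t1))
    (hε : ∀ τ ∈ Set.Icc td t1, |ε τ| < ξstar)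
    (hρb : ∀ τ ∈ Set.Icc td t1, 0 ≤ ρbar τ ∧ ρbar τ ≤ ρmax)
    (hgap : ∀ τ ∈ Set.Icc a t1, μ ≤ ρ τ - ρbar τ)
    (hx : ∀ t ∈ Set.Icc a t1, HasDerivAt x (-b * x t - ε t + ρ t) t)
    (hsmall : ∀ s ∈ Set.Icc a t1,
      |x s| ≤ ξstar / b + ∫ τ in td..s, Real.exp (-b * (s - τ)) * ρbar τ) :
    t1 - a ≤ (1 / b) * Real.log ((μ + 2 * ρmax + ξstar) / (μ - 2 * ξstar)) := by
  have h3 : td ≤ t1 := h1.trans h2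
  obtain ⟨r, hrc, hr⟩ : ∃ r : ℝ → ℝ, Continuous r ∧ ∀ τ ∈ Set.Icc td t1, r τ = ρbar τ := by
    refine ⟨Set.IccExtend h3 (Set.domRestrict (Set.Icc td t1) ρbar), ?_, ?_⟩
    · exact (continuousOn_iff_continuous_domRestrict.1 hρbc).Icc_extend'
    · intro τ hτ
      rw [Set.IccExtend_of_mem h3 _ hτ]; rfl
  have hfc : Continuous (fun τ => Real.exp (b * τ) * r τ) := by fun_prop
  set W : ℝ → ℝ := fun t => ∫ τ in td..t, Real.exp (b * τ) * r τ with hW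
  have hWd : ∀ t, HasDerivAt W (Real.exp (b * t) * r t) t := fun t =>
    intervalIntegral.integral_hasDerivAt_right (hfc.intervalIntegrable _ _)
      (hfc.stronglyMeasurableAtFilter _ _) hfc.continuousAt
  have hV : ∀ s ∈ Set.Icc a t1, (∫ τ in td..s, Real.exp (-b * (s - τ)) * ρbar τ)
      = Real.exp (-(b * s)) * W s := by
    intro s hs
    rw [hW, ← intervalIntegral.integral_const_mul]
    apply intervalIntegral.integral_congr
    intro τ hτ
    rw [Set.uIcc_of_le (h1.trans hs.1)] at hτ
    simp only
    rw [hr τ ⟨hτ.1, hτ.2.trans hs.2⟩, ← mul_assoc, ← Real.exp_add]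
    congr 2; ring
  have hE : ∀ t, HasDerivAt (fun t => Real.exp (b * t)) (Real.exp (b * t) * b) t := by
    intro t
    have := ((hasDerivAt_id t).const_mul b).exp
    simpa using this
  have hWa : b * W a ≤ ρmax * Real.exp (b * a) := by
    have hd : ∀ t, HasDerivAt (fun t => ρmax * Real.exp (b * t) - b * W t)
        (ρmax * (Real.exp (b * t) * b) - b * (Real.exp (b * t) * r t)) t := fun t =>
      ((hE t).const_mul ρmax).sub ((hWd t).const_mul b)
    have hm : MonotoneOn (fun t => ρmax * Real.exp (b * t) - b * W t) (Set.Icc td a) := by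
      apply monotoneOn_of_deriv_nonneg (convex_Icc _ _)
      · exact fun t _ => (hd t).continuousAt.continuousWithinAt
      · exact fun t _ => (hd t).differentiableAt.differentiableWithinAt
      · intro t ht
        rw [interior_Icc] at ht
        have hm : t ∈ Set.Icc td t1 := ⟨ht.1.le, ht.2.le.trans h2⟩
        rw [(hd t).deriv, hr t hm]
        have := (hρb t hm).2
        have : 0 ≤ Real.exp (b * t) * b * (ρmax - ρbar t) :=
          mul_nonneg (by positivity) (by linarith)
        linarith
    have := hm ⟨le_rfl, h1⟩ ⟨h1, le_rfl⟩ h1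
    have h0 : W td = 0 := by simp [hW]
    simp only [h0] at this
    have : 0 ≤ ρmax * Real.exp (b * td) := by positivity
    linarith
  have hd : ∀ t ∈ Set.Icc a t1,
      HasDerivAt (fun t => b * (Real.exp (b * t) * x t - W t) - (μ - ξstar) * Real.exp (b * t))
        (b * ((Real.exp (b * t) * b * x t + Real.exp (b * t) * (-b * x t - ε t + ρ t))
          - Real.exp (b * t) * r t) - (μ - ξstar) * (Real.exp (b * t) * b)) t := fun t ht =>
    ((((hE t).mul (hx t ht)).sub (hWd t)).const_mul b).sub ((hE t).const_mul _)
  have hm : MonotoneOn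
      (fun t => b * (Real.exp (b * t) * x t - W t) - (μ - ξstar) * Real.exp (b * t))
      (Set.Icc a t1) := by
    apply monotoneOn_of_deriv_nonneg (convex_Icc _ _)
    · exact fun t ht => (hd t ht).continuousAt.continuousWithinAt
    · exact fun t ht => (hd t (interior_subset ht)).differentiableAt.differentiableWithinAt
    · intro t ht
      have ht := interior_subset ht
      have hm : t ∈ Set.Icc td t1 := ⟨h1.trans ht.1, ht.2⟩
      rw [(hd t ht).deriv, hr t hm]
      have e1 := (abs_lt.1 (hε t hm)).2
      have e2 := hgap t ht
      have : 0 ≤ Real.exp (b * t) * b * (ρ t - ρbar t - ε t - (μ - ξstar)) :=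
        mul_nonneg (by positivity) (by linarith)
      linarith
  have key := hm ⟨le_rfl, h2⟩ ⟨h2, le_rfl⟩ h2
  simp only at key
  have hs : ∀ s ∈ Set.Icc a t1, b * (Real.exp (b * s) * |x s|) ≤
      ξstar * Real.exp (b * s) + b * W s := by
    intro s hs
    have := hsmall s hs
    rw [hV s hs] at this
    have := mul_le_mul_of_nonneg_left this (show 0 ≤ b * Real.exp (b * s) by positivity)
    have e : Real.exp (b * s) * Real.exp (-(b * s)) = 1 := by
      rw [← Real.exp_add]; simp
    calc _ = b * Real.exp (b * s) * |x s| := by ring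
      _ ≤ _ := this
      _ = ξstar * Real.exp (b * s) * (b / b)
        + b * W s * (Real.exp (b * s) * Real.exp (-(b * s))) := by ring
      _ = _ := by rw [e, div_self hb.ne']; ring
  have ka := hs a ⟨le_rfl, h2⟩
  have k1 := hs t1 ⟨h2, le_rfl⟩
  have p1 : b * (Real.exp (b * t1) * x t1) ≤ b * (Real.exp (b * t1) * |x t1|) := by
    gcongr; exact le_abs_self _
  have pa : b * (Real.exp (b * a) * -|x a|) ≤ b * (Real.exp (b * a) * x a) := by
    gcongr; exact neg_abs_le _
  have fin : (μ - 2 * ξstar) * Real.exp (b * t1) ≤ (μ + 2 * ρmax) * Real.exp (b * a) := by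
    linarith
  have hpos : 0 < μ - 2 * ξstar := by linarith
  have fin2 : Real.exp (b * (t1 - a)) ≤ (μ + 2 * ρmax + ξstar) / (μ - 2 * ξstar) := by
    rw [le_div_iff₀ hpos, mul_sub b, Real.exp_sub, div_mul_eq_mul_div, div_le_iff₀ (Real.exp_pos _)]
    have : 0 ≤ ξstar * Real.exp (b * a) := by positivity
    linarith
  have fin3 : b * (t1 - a) ≤ Real.log ((μ + 2 * ρmax + ξstar) / (μ - 2 * ξstar)) := by
    rw [Real.le_log_iff_exp_le (div_pos (by linarith) hpos)]; exact fin2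
  rw [one_div, ← div_eq_inv_mul, le_div_iff₀ hb]
  linarith


/-- Bound on the length of the subinterval `I₂ᵏ` (Eq. (34) of the paper) on
which the mismatched fault-isolation residual `x' = -b x - ε + ρ` can remain
below the adaptive-threshold kernel
`ϑ(t) = ξ*/b + ∫_{t_d}^t e^{-b(t-τ)} ρ̄(τ) dτ`. -/
theorem mismatched_residual_below_kernel_subinterval_length_bound
    (b ξstar ρmax μ td a t1 : ℝ)
    (hb : 0 < b) (hξ : 0 < ξstar) (hρmax : 0 ≤ ρmax) (hμ : 2 * ξstar < μ)
    (h1 : td ≤ a) (h2 : a ≤ t1)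
    (ε ρ ρbar x : ℝ → ℝ)
    (hεc : ContinuousOn ε (Set.Icc td t1))
    (hρc : ContinuousOn ρ (Set.Icc td t1))
    (hρbc : ContinuousOn ρbar (Set.Icc td t1))
    (hε : ∀ τ ∈ Set.Icc td t1, |ε τ| < ξstar)
    (hρb : ∀ τ ∈ Set.Icc td t1, 0 ≤ ρbar τ ∧ ρbar τ ≤ ρmax)
    (hgap : ∀ τ ∈ Set.Icc a t1, μ ≤ |ρ τ| - ρbar τ)
    (hx : ∀ t ∈ Set.Icc a t1, HasDerivAt x (-b * x t - ε t + ρ t) t)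
    (hsmall : ∀ s ∈ Set.Icc a t1,
      |x s| ≤ ξstar / b + ∫ τ in td..s, Real.exp (-b * (s - τ)) * ρbar τ) :
    t1 - a ≤ (1 / b) * Real.log ((μ + 2 * ρmax + ξstar) / (μ - 2 * ξstar)) := by
  have hne : ∀ τ ∈ Set.Icc a t1, ρ τ ≠ 0 := by
    intro τ hτ h0
    have := hgap τ hτ
    have := (hρb τ ⟨h1.trans hτ.1, hτ.2⟩).1
    rw [h0, abs_zero] at *
    linarith
  have hc : ContinuousOn ρ (Set.Icc a t1) := hρc.mono (Set.Icc_subset_Icc_left h1)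
  by_cases hp : ∀ τ ∈ Set.Icc a t1, 0 ≤ ρ τ
  · refine aux_pos b ξstar ρmax μ td a t1 hb hξ hρmax hμ h1 h2 ε ρ ρbar x hρbc hε hρb ?_ hx hsmall
    intro τ hτ
    have := hgap τ hτ
    rwa [abs_of_nonneg (hp τ hτ)] at this
  · push Not at hp
    obtain ⟨s, hs, hs0⟩ := hp
    have hn : ∀ τ ∈ Set.Icc a t1, ρ τ ≤ 0 := by
      intro τ hτ
      by_contra hcon
      push Not at hcon
      obtain ⟨z, hz, hz0⟩ := isPreconnected_Icc.intermediate_value hs hτ hc ⟨hs0.le, hcon.le⟩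
      exact hne z hz hz0
    refine aux_pos b ξstar ρmax μ td a t1 hb hξ hρmax hμ h1 h2 (fun t => -ε t) (fun t => -ρ t)
      ρbar (fun t => -x t) hρbc ?_ hρb ?_ ?_ ?_
    · intro τ hτ
      simpa using hε τ hτ
    · intro τ hτ
      have := hgap τ hτ
      rwa [abs_of_nonpos (hn τ hτ)] at this
    · intro t ht
      have e : -b * -x t - -ε t + -ρ t = -(-b * x t - ε t + ρ t) := by ring
      have h := (hx t ht).fun_neg
      rw [← e] at h
      exact h
    · intro s hs
      simpa using hsmall s hs
end

section
/- (Fault isolatability, core of Theorem 3.) Let $b > 0$, $T > 0$, $\xi^* > 0$, $\bar{\rho}_{\max} \ge 0$, $\mu > 2\xi^*$, and real numbers $t_d \le t_b - T \le t_a \le t_b$; set $l := t_b - t_a$. Let $\varepsilon, \rho, \bar{\rho} : \mathbb{R} \to \mathbb{R}$ be continuous on $[t_d, t_b]$ with $|\varepsilon(\tau)| < \xi^*$ and $0 \le \bar{\rho}(\tau) \le \bar{\rho}_{\max}$ on $[t_d, t_b]$, and $|\rho(\tau)| - \bar{\rho}(\tau) \ge \mu$ for all $\tau \in [t_a, t_b]$.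 Suppose $\tilde{x}$ is differentiable on $[t_d, t_b]$ with $\tilde{x}(t_d) = 0$ and $\tilde{x}'(t) = -b\,\tilde{x}(t) - \varepsilon(t) + \rho(t)$ there. If $l \ge \frac{2\xi^* + 2\bar{\rho}_{\max}}{\mu + 2\bar{\rho}_{\max}}\left( T + \frac{1}{b}\ln\frac{\mu + 2\bar{\rho}_{\max} + \xi^*}{\mu - 2\xi^*} \right) + \frac{\mu - 2\xi^*}{\mu + 2\bar{\rho}_{\max}} \cdot \frac{1}{b}\ln\frac{3\mu + 4\bar{\rho}_{\max}}{\mu - 2\xi^*}$, then $\frac{1}{T}\int_{t_b - T}^{t_b} |\tilde{x}(\tau)|\, d\tau > \frac{\xi^*}{b} + \frac{1}{T}\int_{t_b - T}^{t_b}\left( \int_{t_d}^{s} e^{-b(s-\tau)}\, \bar{\rho}(\tau)\, d\tau \right) ds$, i.e., the mismatched fault-isolation residual exceeds the adaptive threshold $\bar{e}^k(t_b)$ at time $t_b$, so the trained fault $k$ is excluded as a match for the occurring fault. -/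
lemma fi_plog (p : ℝ) (hp : 0 < p) (hp1 : p ≤ 1) :
    0 < p * Real.log (1 + p) + p * Real.log p + p * Real.log (2 + p)
      + (2 * p + 1) * Real.log 2 - (2 * p + 1) * Real.log (2 * p + 1) := by
  have h1 : Real.log (2 * p + 1) = Real.log 2 + Real.log (p + 1 / 2) := by
    rw [← Real.log_mul (by norm_num) (by positivity)]; congr 1; ring
  have h2 : Real.log (8 / 3) + 2 * Real.log (p + 1 / 2) ≤ Real.log (1 + p) + Real.log (2 + p) := by
    have : 2 * Real.log (p + 1 / 2) = Real.log ((p + 1 / 2) ^ 2) := by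
      rw [Real.log_pow]; norm_num
    rw [this, ← Real.log_mul (by norm_num) (by positivity),
      ← Real.log_mul (by positivity) (by positivity)]
    apply Real.log_le_log (by positivity)
    nlinarith
  have h3 : Real.log (p + 1 / 2) ≤ p - 1 / 2 := by
    have := Real.log_le_sub_one_of_pos (x := p + 1 / 2) (by positivity)
    linarith
  have h4 : p - 3 / 8 ≤ p * (Real.log (8 / 3) + Real.log p) := by
    rw [← Real.log_mul (by norm_num) (by positivity)]
    have := Real.one_sub_inv_le_log_of_pos (x := 8 / 3 * p) (by positivity)
    have h5 := mul_le_mul_of_nonneg_left this hp.le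
    have : p * (1 - (8 / 3 * p)⁻¹) = p - 3 / 8 := by field_simp
    linarith
  have h6 := mul_le_mul_of_nonneg_left h2 hp.le
  rw [h1]
  nlinarith

lemma fi_core (ξ m μ D L S : ℝ) (hξ : 0 < ξ) (hm : 0 ≤ m) (hμ : 2 * ξ < μ)
    (hl : (2 * ξ + 2 * m) / (μ + 2 * m) * (S + Real.log ((μ + 2 * m + ξ) / (μ - 2 * ξ))) +
        (μ - 2 * ξ) / (μ + 2 * m) * Real.log ((3 * μ + 4 * m) / (μ - 2 * ξ)) ≤ D + L) :
    S * (m + ξ) < m * L + (μ - ξ) * (Real.exp D - 1 - D) + (μ - ξ) * L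
      - (m + (μ - ξ)) * (1 - Real.exp (-L)) := by
  obtain ⟨q, hq⟩ : ∃ q, q = μ / 2 - ξ := ⟨_, rfl⟩
  have hq0 : 0 < q := by linarith
  obtain ⟨β, hβ⟩ : ∃ β, β = μ / 2 + m := ⟨_, rfl⟩
  have hβ0 : 0 < β := by linarith
  obtain ⟨p, hp⟩ : ∃ p, p = q / β := ⟨_, rfl⟩
  have hp0 : 0 < p := by rw [hp]; positivity
  have hp1 : p ≤ 1 := by rw [hp, div_le_one hβ0]; linarith
  have hqp : q = p * β := by rw [hp]; field_simp
  have hA : - Real.log p ≤ Real.log ((μ + 2 * m + ξ) / (μ - 2 * ξ)) := by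
    rw [← Real.log_inv]
    apply Real.log_le_log (by positivity)
    rw [hp, inv_div, div_le_div_iff₀ hq0 (by linarith)]
    nlinarith
  have hB : Real.log (2 + p) - Real.log p ≤ Real.log ((3 * μ + 4 * m) / (μ - 2 * ξ)) := by
    rw [← Real.log_div (by positivity) (by positivity)]
    apply Real.log_le_log (by positivity)
    have : (2 + p) / p = (2 * β + q) / q := by rw [hp]; field_simp
    rw [this, div_le_div_iff₀ hq0 (by linarith)]
    nlinarith
  generalize Real.log ((μ + 2 * m + ξ) / (μ - 2 * ξ)) = lA at *
  generalize Real.log ((3 * μ + 4 * m) / (μ - 2 * ξ)) = lB at *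
  have hl2 : (β - q) * (S + lA) + q * lB ≤ β * (D + L) := by
    have h := mul_le_mul_of_nonneg_left hl hβ0.le
    have e : β * ((2 * ξ + 2 * m) / (μ + 2 * m) * (S + lA) + (μ - 2 * ξ) / (μ + 2 * m) * lB)
        = (β - q) * (S + lA) + q * lB := by
      have : μ + 2 * m = 2 * β := by linarith
      rw [this, show 2 * ξ + 2 * m = 2 * (β - q) by linarith,
        show μ - 2 * ξ = 2 * q by linarith]
      field_simp
    linarith
  have hA' := mul_le_mul_of_nonneg_left hA (show 0 ≤ β - q by linarith)
  have hB' := mul_le_mul_of_nonneg_left hB hq0.le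
  have hD1 : 0 ≤ Real.exp D - 1 - D := by linarith [Real.add_one_le_exp D]
  have hD2 := mul_le_mul_of_nonneg_right (show 2 * q ≤ μ - ξ by linarith) hD1
  have hD3 : (2 * q + β) * (1 + D - (Real.log (2 * p + 1) - (Real.log 2 + Real.log p)))
      ≤ 2 * q * Real.exp D := by
    have h := Real.add_one_le_exp (D - Real.log ((2 * p + 1) / (2 * p)))
    rw [Real.exp_sub, Real.exp_log (by positivity), Real.log_div (by positivity) (by positivity),
      Real.log_mul (by norm_num) (by positivity)] at h
    have h' := mul_le_mul_of_nonneg_left h (show 0 ≤ 2 * q + β by linarith)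
    have e : (2 * q + β) * (Real.exp D / ((2 * p + 1) / (2 * p))) = 2 * q * Real.exp D := by
      rw [hqp]; field_simp
    linarith
  have hL3 : q * (1 - L + (Real.log (1 + p) - Real.log p)) ≤ (β + q) * Real.exp (-L) := by
    have h := Real.add_one_le_exp (-L + Real.log ((1 + p) / p))
    rw [Real.exp_add, Real.exp_log (by positivity),
      Real.log_div (by positivity) (by positivity)] at h
    have h' := mul_le_mul_of_nonneg_left h hq0.le
    have e : q * (Real.exp (-L) * ((1 + p) / p)) = (β + q) * Real.exp (-L) := by
      rw [hqp]; field_simp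
    linarith
  have hF := mul_pos hβ0 (fi_plog p hp0 hp1)
  have e1 : m + (μ - ξ) = β + q := by linarith
  have e2 : m + ξ = β - q := by linarith
  have e3 : m * L + (μ - ξ) * L = (β + q) * L := by rw [← e1]; ring
  rw [e1, e2]
  rw [hqp] at *
  nlinarith

lemma fi_int (F F' f : ℝ → ℝ) (u v : ℝ) (huv : u ≤ v)
    (hF : ∀ t, HasDerivAt F (F' t) t) (hf : ContinuousOn f (Set.Icc u v))
    (h : ∀ t ∈ Set.Icc u v, F' t ≤ f t) : F v - F u ≤ ∫ t in u..v, f t := by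
  apply intervalIntegral.sub_le_integral_of_hasDeriv_right_of_le huv
    (fun t _ => (hF t).continuousAt.continuousWithinAt)
    (fun t _ => (hF t).hasDerivWithinAt) hf.integrableOn_Icc
    (fun t ht => h t (Set.Ioo_subset_Icc_self ht))

/-- positive-sign case, with `r` globally continuous -/
lemma fi_pos (b T ξ m μ td ta tb : ℝ)
    (hb : 0 < b) (hT : 0 < T) (hξ : 0 < ξ) (hm : 0 ≤ m) (hμ : 2 * ξ < μ)
    (h0 : td ≤ tb - T) (h1 : tb - T ≤ ta) (h2 : ta ≤ tb)
    (ε ρ r x : ℝ → ℝ) (hr : Continuous r)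
    (hε : ∀ τ ∈ Set.Icc td tb, |ε τ| < ξ)
    (hrb : ∀ τ, 0 ≤ r τ ∧ r τ ≤ m)
    (hgap : ∀ τ ∈ Set.Icc ta tb, μ ≤ ρ τ - r τ)
    (hx : ∀ t ∈ Set.Icc td tb, HasDerivAt x (-b * x t - ε t + ρ t) t)
    (hl : (2 * ξ + 2 * m) / (μ + 2 * m) *
          (T + (1 / b) * Real.log ((μ + 2 * m + ξ) / (μ - 2 * ξ))) +
        (μ - 2 * ξ) / (μ + 2 * m) *
          ((1 / b) * Real.log ((3 * μ + 4 * m) / (μ - 2 * ξ))) ≤ tb - ta) :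
    ξ / b + (1 / T) * (∫ s in (tb - T)..tb, ∫ τ in td..s, Real.exp (-b * (s - τ)) * r τ) <
      (1 / T) * (∫ τ in (tb - T)..tb, |x τ|) := by
  obtain ⟨κ, hκ⟩ : ∃ κ, κ = μ - ξ := ⟨_, rfl⟩
  have hκ0 : 0 < κ := by linarith
  obtain ⟨W, hW⟩ : ∃ W : ℝ → ℝ, W = fun s => ∫ τ in td..s, Real.exp (b * τ) * r τ := ⟨_, rfl⟩
  have hexp : ∀ t, HasDerivAt (fun t => Real.exp (b * t)) (Real.exp (b * t) * b) t := by
    intro t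
    simpa using ((hasDerivAt_id t).const_mul b).exp
  have hWc : Continuous (fun τ => Real.exp (b * τ) * r τ) := by fun_prop
  have hWd : ∀ t, HasDerivAt W (Real.exp (b * t) * r t) t := by
    intro t
    rw [hW]
    exact hWc.integral_hasStrictDerivAt td t |>.hasDerivAt
  have hW0 : W td = 0 := by rw [hW]; simp
  have hY : ∀ s, (∫ τ in td..s, Real.exp (-b * (s - τ)) * r τ) = Real.exp (-(b * s)) * W s := by
    intro s
    rw [hW]
    simp only
    rw [← intervalIntegral.integral_const_mul]
    congr 1
    ext τ
    rw [← mul_assoc, ← Real.exp_add]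
    congr 2; ring
  simp_rw [hY]
  obtain ⟨Y, hYd⟩ : ∃ Y : ℝ → ℝ, Y = fun s => Real.exp (-(b * s)) * W s := ⟨_, rfl⟩
  have hYs : ∀ s, Real.exp (-(b * s)) * W s = Y s := fun s => by rw [hYd]
  have hWY : ∀ s, W s = Real.exp (b * s) * Y s := by
    intro s; rw [hYd]; simp only; rw [← mul_assoc, ← Real.exp_add]; simp
  have hWcont : Continuous W := continuous_iff_continuousAt.2 fun t => (hWd t).continuousAt
  have hYc : Continuous Y := by rw [hYd]; fun_prop
  simp_rw [hYs]
  -- upper bound on Y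
  have hYle : ∀ s, td ≤ s → Y s ≤ m / b := by
    intro s hs
    have hmono : MonotoneOn (fun t => m / b * Real.exp (b * t) - W t) (Set.Icc td s) := by
      refine monotoneOn_of_hasDerivWithinAt_nonneg (convex_Icc _ _)
        (f' := fun t => m / b * (Real.exp (b * t) * b) - Real.exp (b * t) * r t) ?_ ?_ ?_
      · fun_prop
      · intro t _
        exact (((hexp t).const_mul (m / b)).sub (hWd t)).hasDerivWithinAt
      · intro t _
        have e : m / b * (Real.exp (b * t) * b) = Real.exp (b * t) * m := by field_simp
        have := mul_le_mul_of_nonneg_left (hrb t).2 (Real.exp_pos (b * t)).le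
        rw [e]; linarith
    have h := hmono (Set.left_mem_Icc.2 hs) (Set.right_mem_Icc.2 hs) hs
    simp only [hW0] at h
    have h3 : 0 ≤ m / b * Real.exp (b * td) := by positivity
    rw [hWY s] at h
    have h4 : Real.exp (b * s) * Y s ≤ Real.exp (b * s) * (m / b) := by linarith
    exact le_of_mul_le_mul_left h4 (Real.exp_pos _)
  have hxc : ContinuousOn x (Set.Icc td tb) :=
    fun t ht => (hx t ht).continuousAt.continuousWithinAt
  have hsub : ∀ t ∈ Set.Icc ta tb, t ∈ Set.Icc td tb := fun t ht => ⟨by linarith [ht.1], ht.2⟩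
  -- monotone quantities
  have hmonoG : ∀ c : ℝ, 0 ≤ c → c ≤ 1 →
      MonotoneOn (fun t => Real.exp (b * t) * x t - κ / b * Real.exp (b * t) - c * W t)
      (Set.Icc ta tb) := by
    intro c hc hc1
    refine monotoneOn_of_hasDerivWithinAt_nonneg (convex_Icc _ _)
      (f' := fun t => Real.exp (b * t) * b * x t + Real.exp (b * t) * (-b * x t - ε t + ρ t)
        - κ / b * (Real.exp (b * t) * b) - c * (Real.exp (b * t) * r t)) ?_ ?_ ?_
    · have := hxc.mono (fun t ht => hsub t ht)
      fun_prop
    · intro t ht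
      have ht' := interior_subset ht
      exact ((((hexp t).mul (hx t (hsub t ht'))).sub ((hexp t).const_mul (κ / b))).sub
        ((hWd t).const_mul c)).hasDerivWithinAt
    · intro t ht
      have ht' := interior_subset ht
      have e : Real.exp (b * t) * b * x t + Real.exp (b * t) * (-b * x t - ε t + ρ t)
        - κ / b * (Real.exp (b * t) * b) - c * (Real.exp (b * t) * r t)
        = Real.exp (b * t) * (ρ t - ε t - κ - c * r t) := by field_simp; ring
      rw [e]
      apply mul_nonneg (Real.exp_pos _).le
      have a1 := (abs_lt.1 (hε t (hsub t ht'))).2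
      have a2 := hgap t ht'
      have a3 := (hrb t).1
      nlinarith
  obtain ⟨t0, ht0, hc1, hc2⟩ : ∃ t0 ∈ Set.Icc ta tb, (t0 = ta ∨ x t0 ≤ 0) ∧
      (t0 = tb ∨ 0 ≤ x t0) := by
    by_cases ha : 0 ≤ x ta
    · exact ⟨ta, ⟨le_rfl, h2⟩, Or.inl rfl, Or.inr ha⟩
    by_cases hbb : x tb ≤ 0
    · exact ⟨tb, ⟨h2, le_rfl⟩, Or.inr hbb, Or.inl rfl⟩
    push Not at ha hbb
    obtain ⟨t0, ht0, hx0⟩ := intermediate_value_Icc h2 (hxc.mono (fun t ht => hsub t ht))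
      (show (0 : ℝ) ∈ Set.Icc (x ta) (x tb) from ⟨ha.le, hbb.le⟩)
    exact ⟨t0, ht0, Or.inr hx0.le, Or.inr hx0.ge⟩
  have hcross : ∀ u v : ℝ, Real.exp (b * u) = Real.exp (b * v) * Real.exp (b * (u - v)) := by
    intro u v; rw [← Real.exp_add]; congr 1; ring
  -- pointwise bounds
  have hp1 : ∀ t ∈ Set.Icc (tb - T) ta, - (m / b) ≤ |x t| - Y t := by
    intro t ht
    linarith [abs_nonneg (x t), hYle t (by linarith [ht.1])]
  have hp2 : ∀ t ∈ Set.Icc ta t0, κ / b * (Real.exp (b * (t0 - t)) - 1) - m / b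
      ≤ |x t| - Y t := by
    intro t ht
    have hy := hYle t (by linarith [ht.1])
    suffices κ / b * (Real.exp (b * (t0 - t)) - 1) ≤ |x t| by linarith
    rcases hc1 with hc | hc
    · have : t = t0 := le_antisymm ht.2 (by rw [hc]; exact ht.1)
      rw [this]; simp
    · have h := hmonoG 0 le_rfl zero_le_one (show t ∈ Set.Icc ta tb from
        ⟨ht.1, ht.2.trans ht0.2⟩) ht0 ht.2
      simp only [zero_mul, sub_zero] at h
      rw [hcross t0 t] at h
      have e0 := Real.exp_pos (b * t)
      have e1 := Real.exp_pos (b * (t0 - t))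
      have h5 : Real.exp (b * t) * Real.exp (b * (t0 - t)) * x t0 ≤ 0 :=
        mul_nonpos_of_nonneg_of_nonpos (by positivity) hc
      have h6 : Real.exp (b * t) * (κ / b * (Real.exp (b * (t0 - t)) - 1))
          ≤ Real.exp (b * t) * (- x t) := by nlinarith
      exact (le_of_mul_le_mul_left h6 e0).trans (neg_le_abs _)
  have hp3 : ∀ t ∈ Set.Icc t0 tb, κ / b - (m + κ) / b * Real.exp (-(b * (t - t0)))
      ≤ |x t| - Y t := by
    intro t ht
    have hy := hYle t (by linarith [ht.1, ht0.1])
    have hy0 := hYle t0 (by linarith [ht0.1])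
    rcases hc2 with hc | hc
    · have : t = t0 := le_antisymm (by rw [hc]; exact ht.2) ht.1
      rw [this] at hy ⊢
      have : κ / b - (m + κ) / b * Real.exp (-(b * (t0 - t0))) = - (m / b) := by
        simp; ring
      rw [this]; linarith [abs_nonneg (x t0)]
    · have h := hmonoG 1 zero_le_one le_rfl ht0 (show t ∈ Set.Icc ta tb from
        ⟨ht0.1.trans ht.1, ht.2⟩) ht.1
      simp only [one_mul, hWY] at h
      rw [hcross t0 t, show b * (t0 - t) = -(b * (t - t0)) by ring] at h
      have e0 := Real.exp_pos (b * t)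
      have e1 := Real.exp_pos (-(b * (t - t0)))
      set E := Real.exp (-(b * (t - t0)))
      have h5 : Real.exp (b * t) * (E * (x t0 - κ / b - Y t0))
          ≤ Real.exp (b * t) * (x t - κ / b - Y t) := by linarith
      have h6 := le_of_mul_le_mul_left h5 e0
      have h7 : E * (- (m / b) - κ / b) ≤ E * (x t0 - κ / b - Y t0) :=
        mul_le_mul_of_nonneg_left (by linarith) e1.le
      have h8 : (m + κ) / b * E = - (E * (- (m / b) - κ / b)) := by ring
      linarith [le_abs_self (x t)]
  have hfc : ContinuousOn (fun t => |x t| - Y t) (Set.Icc td tb) :=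
    hxc.abs.sub hYc.continuousOn
  have hI1 := fi_int (fun t => -(m / b) * t) (fun _ => -(m / b)) (fun t => |x t| - Y t)
    (tb - T) ta h1 (fun t => by simpa using (hasDerivAt_id t).const_mul (-(m / b)))
    (hfc.mono (Set.Icc_subset_Icc h0 h2)) hp1
  have hI2 := fi_int (fun t => κ / b * (-(Real.exp (b * (t0 - t)) / b) - t) - m / b * t)
    (fun t => κ / b * (Real.exp (b * (t0 - t)) - 1) - m / b) (fun t => |x t| - Y t)
    ta t0 ht0.1 (fun t => by
      have h := ((((hasDerivAt_id t).const_sub t0).const_mul b).exp.div_const b).neg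
      have h' := ((h.sub (hasDerivAt_id t)).const_mul (κ / b)).sub
        ((hasDerivAt_id t).const_mul (m / b))
      refine HasDerivAt.congr_deriv h' ?_
      simp only [id]; field_simp; try ring)
    (hfc.mono (Set.Icc_subset_Icc (by linarith) ht0.2)) hp2
  have hI3 := fi_int (fun t => κ / b * t + (m + κ) / b * (Real.exp (-(b * (t - t0))) / b))
    (fun t => κ / b - (m + κ) / b * Real.exp (-(b * (t - t0)))) (fun t => |x t| - Y t)
    t0 tb ht0.2 (fun t => by
      have h := (((((hasDerivAt_id t).sub_const t0).const_mul b).neg).exp.div_const b)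
      have h' := ((hasDerivAt_id t).const_mul (κ / b)).add (h.const_mul ((m + κ) / b))
      refine HasDerivAt.congr_deriv h' ?_
      simp; field_simp; try ring)
    (hfc.mono (Set.Icc_subset_Icc (by linarith [ht0.1]) le_rfl)) hp3
  have hii : ∀ u v, td ≤ u → u ≤ v → v ≤ tb →
      IntervalIntegrable (fun t => |x t| - Y t) MeasureTheory.volume u v := by
    intro u v hu huv hv
    exact (hfc.mono (Set.Icc_subset_Icc hu hv)).intervalIntegrable_of_Icc huv
  have hadd : (∫ t in (tb - T)..tb, (|x t| - Y t)) = (∫ t in (tb - T)..ta, (|x t| - Y t)) +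
      (∫ t in ta..t0, (|x t| - Y t)) + (∫ t in t0..tb, (|x t| - Y t)) := by
    rw [intervalIntegral.integral_add_adjacent_intervals (hii _ _ h0 h1 h2)
      (hii _ _ (by linarith) ht0.1 ht0.2),
      intervalIntegral.integral_add_adjacent_intervals
      (hii _ _ h0 (by linarith [ht0.1]) ht0.2) (hii _ _ (by linarith [ht0.1]) ht0.2 le_rfl)]
  have hsubI : (∫ t in (tb - T)..tb, (|x t| - Y t)) =
      (∫ t in (tb - T)..tb, |x t|) - ∫ t in (tb - T)..tb, Y t := by
    apply intervalIntegral.integral_sub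
    · exact ((hxc.abs).mono (Set.Icc_subset_Icc h0 le_rfl)).intervalIntegrable_of_Icc
        (by linarith)
    · exact hYc.intervalIntegrable _ _
  have hcore := fi_core ξ m μ (b * (t0 - ta)) (b * (tb - t0)) (b * T) hξ hm hμ (by
    have h := mul_le_mul_of_nonneg_left hl hb.le
    generalize Real.log ((μ + 2 * m + ξ) / (μ - 2 * ξ)) = lA at *
    generalize Real.log ((3 * μ + 4 * m) / (μ - 2 * ξ)) = lB at *
    have hpos : 0 < μ + 2 * m := by linarith
    refine le_trans (le_of_eq ?_) (h.trans (le_of_eq ?_))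
    · field_simp
    · ring)
  rw [← hκ] at hcore
  have hkey : ξ / b * T < ∫ t in (tb - T)..tb, (|x t| - Y t) := by
    rw [hadd]
    refine lt_of_lt_of_le ?_ (add_le_add (add_le_add hI1 hI2) hI3)
    simp only [sub_self, mul_zero, neg_zero, Real.exp_zero]
    generalize Real.exp (b * (t0 - ta)) = E1 at *
    generalize Real.exp (-(b * (tb - t0))) = E2 at *
    rw [← sub_pos] at hcore ⊢
    have := div_pos hcore (show 0 < b ^ 2 by positivity)
    convert this using 1
    field_simp
    ring
  rw [hsubI] at hkey
  have h9 : ξ / b = (1 / T) * (ξ / b * T) := by field_simp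
  rw [h9, ← mul_add]
  apply mul_lt_mul_of_pos_left _ (by positivity)
  linarith

/-- Fault isolatability (core of Theorem 3 of the paper): for a mismatched
fault-isolation estimator with residual system `x' = -b x - ε + ρ`,
`x t_d = 0`, if the mismatch gap `|ρ| - ρ̄` is at least `μ > 2ξ*` on an
interval `[t_a, t_b] ⊆ [t_b - T, t_b]` of sufficient length `l = t_b - t_a`,
then the windowed `L¹` residual exceeds the adaptive threshold at time `t_b`,
excluding the trained fault `k` as a match. -/
theorem fault_isolatability
    (b T ξstar ρmax μ td ta tb : ℝ)
    (hb : 0 < b) (hT : 0 < T) (hξ : 0 < ξstar) (hρmax : 0 ≤ ρmax)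
    (hμ : 2 * ξstar < μ)
    (h0 : td ≤ tb - T) (h1 : tb - T ≤ ta) (h2 : ta ≤ tb)
    (ε ρ ρbar x : ℝ → ℝ)
    (hεc : ContinuousOn ε (Set.Icc td tb))
    (hρc : ContinuousOn ρ (Set.Icc td tb))
    (hρbc : ContinuousOn ρbar (Set.Icc td tb))
    (hε : ∀ τ ∈ Set.Icc td tb, |ε τ| < ξstar)
    (hρb : ∀ τ ∈ Set.Icc td tb, 0 ≤ ρbar τ ∧ ρbar τ ≤ ρmax)
    (hgap : ∀ τ ∈ Set.Icc ta tb, μ ≤ |ρ τ| - ρbar τ)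
    (hx0 : x td = 0)
    (hx : ∀ t ∈ Set.Icc td tb, HasDerivAt x (-b * x t - ε t + ρ t) t)
    (hl : (2 * ξstar + 2 * ρmax) / (μ + 2 * ρmax) *
          (T + (1 / b) * Real.log ((μ + 2 * ρmax + ξstar) / (μ - 2 * ξstar))) +
        (μ - 2 * ξstar) / (μ + 2 * ρmax) *
          ((1 / b) * Real.log ((3 * μ + 4 * ρmax) / (μ - 2 * ξstar))) ≤ tb - ta) :
    ξstar / b +
        (1 / T) * (∫ s in (tb - T)..tb, ∫ τ in td..s, Real.exp (-b * (s - τ)) * ρbar τ) <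
      (1 / T) * (∫ τ in (tb - T)..tb, |x τ|) := by
  have htd : td ≤ tb := by linarith
  let r : ℝ → ℝ := Set.IccExtend htd ((Set.Icc td tb).domRestrict ρbar)
  have hr : Continuous r := (continuousOn_iff_continuous_domRestrict.1 hρbc).Icc_extend'
  have hre : ∀ t ∈ Set.Icc td tb, r t = ρbar t := fun t ht => by
    simp only [r]
    rw [Set.IccExtend_of_mem _ _ ht]; rfl
  have hrb : ∀ τ, 0 ≤ r τ ∧ r τ ≤ ρmax := fun τ =>
    hρb _ (Set.projIcc td tb htd τ).2
  have hint : (∫ s in (tb - T)..tb, ∫ τ in td..s, Real.exp (-b * (s - τ)) * ρbar τ)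
      = ∫ s in (tb - T)..tb, ∫ τ in td..s, Real.exp (-b * (s - τ)) * r τ := by
    apply intervalIntegral.integral_congr
    intro s hs
    rw [Set.uIcc_of_le (by linarith)] at hs
    apply intervalIntegral.integral_congr
    intro τ hτ
    rw [Set.uIcc_of_le (by linarith [hs.1])] at hτ
    simp only
    rw [hre τ ⟨hτ.1, hτ.2.trans hs.2⟩]
  rw [hint]
  have hsub : ∀ t ∈ Set.Icc ta tb, t ∈ Set.Icc td tb := fun t ht => ⟨by linarith [ht.1], ht.2⟩
  have hne : ∀ t ∈ Set.Icc ta tb, ρ t ≠ 0 := by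
    intro t ht h
    have h3 := hgap t ht
    rw [h, abs_zero] at h3
    linarith [(hρb t (hsub t ht)).1]
  have hsign : (∀ t ∈ Set.Icc ta tb, 0 < ρ t) ∨ (∀ t ∈ Set.Icc ta tb, ρ t < 0) := by
    by_contra hcon
    push Not at hcon
    obtain ⟨⟨u, hu, hu0⟩, v, hv, hv0⟩ := hcon
    obtain ⟨w, hw, hw0⟩ := isPreconnected_Icc.intermediate_value hu hv
      (hρc.mono (fun t ht => hsub t ht)) (show (0 : ℝ) ∈ Set.Icc (ρ u) (ρ v) from ⟨hu0, hv0⟩)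
    exact hne w hw hw0
  rcases hsign with hs | hs
  · refine fi_pos b T ξstar ρmax μ td ta tb hb hT hξ hρmax hμ h0 h1 h2 ε ρ r x hr hε hrb ?_ hx hl
    intro t ht
    have h3 := hgap t ht
    rw [abs_of_pos (hs t ht)] at h3
    rw [hre t (hsub t ht)]; exact h3
  · have h := fi_pos b T ξstar ρmax μ td ta tb hb hT hξ hρmax hμ h0 h1 h2 (fun t => - ε t)
      (fun t => - ρ t) r (fun t => - x t) hr (by simpa using hε) hrb ?_ ?_ hl
    · simpa using h
    · intro t ht
      have h3 := hgap t ht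
      rw [abs_of_neg (hs t ht)] at h3
      rw [hre t (hsub t ht)]; exact h3
    · intro t ht
      refine HasDerivAt.congr_deriv (hx t ht).neg ?_
      ring
end

section
/- Let $N \in \mathbb{N}_+$, let $\Gamma \in \mathbb{R}^{N \times N}$ be symmetric positive definite, and let $\gamma > 0$ satisfy $v^\top \Gamma^{-1} v \le \|v\|^2/\gamma$ for all $v \in \mathbb{R}^N$. Let $a > 0$, $\sigma > 0$, $\varepsilon^* \ge 0$, $W^* \in \mathbb{R}^N$, and let $S : \mathbb{R} \to \mathbb{R}^N$ and $\varepsilon : \mathbb{R} \to \mathbb{R}$ be continuous with $|\varepsilon(t)| \le \varepsilon^*$ for all $t \ge 0$. Suppose $(\tilde{x}, \tilde{W}) : [0, \infty) \to \mathbb{R} \times \mathbb{R}^N$ is continuously differentiable and satisfies $\tilde{x}' = -a\,\tilde{x} + \tilde{W}^\top S(t) - \varepsilon(t)$ and $\tilde{W}' = -\sigma\Gamma(\tilde{W} + W^*) - \Gamma\,\tilde{x}\,S(t)$. Set $V(t) := \frac{1}{2}\tilde{x}(t)^2 + \frac{1}{2}\tilde{W}(t)^\top \Gamma^{-1}\tilde{W}(t)$,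 $\kappa := \min\{a, \sigma\gamma\}$, and $\delta := \frac{(\varepsilon^*)^2}{2a} + \frac{\sigma \|W^*\|^2}{2}$. Then for all $t \ge 0$: $V(t) \le V(0)\,e^{-\kappa t} + \frac{\delta}{\kappa}\left(1 - e^{-\kappa t}\right)$. In particular, all signals $\tilde{x}$ and $\tilde{W}$ remain bounded, and $\limsup_{t \to \infty} \tilde{x}(t)^2 \le \frac{2\delta}{\kappa}$, so the estimation error converges to a small neighborhood of the origin. -/
open Matrix

lemma aux_hasDerivAt_dot {N : ℕ} {u v : ℝ → Fin N → ℝ} {u' v' : Fin N → ℝ} {t : ℝ}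
    (hu : HasDerivAt u u' t) (hv : HasDerivAt v v' t) :
    HasDerivAt (fun s => u s ⬝ᵥ v s) (u' ⬝ᵥ v t + u t ⬝ᵥ v') t := by
  have h : HasDerivAt (fun s => ∑ i, u s i * v s i) (∑ i, (u' i * v t i + u t i * v' i)) t :=
    HasDerivAt.fun_sum fun i _ => (hasDerivAt_pi.1 hu i).mul (hasDerivAt_pi.1 hv i)
  rw [Finset.sum_add_distrib] at h
  exact h

lemma aux_hasDerivAt_mulVec {N : ℕ} (A : Matrix (Fin N) (Fin N) ℝ) {u : ℝ → Fin N → ℝ}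
    {u' : Fin N → ℝ} {t : ℝ} (hu : HasDerivAt u u' t) :
    HasDerivAt (fun s => A *ᵥ u s) (A *ᵥ u') t :=
  (LinearMap.toContinuousLinearMap (Matrix.mulVecLin A)).hasFDerivAt.comp_hasDerivAt t hu

lemma aux_symm {N : ℕ} {A : Matrix (Fin N) (Fin N) ℝ} (hA : A.PosDef) (u v : Fin N → ℝ) :
    u ⬝ᵥ (A *ᵥ v) = v ⬝ᵥ (A *ᵥ u) := by
  have hT : Aᵀ = A := by
    have := hA.isHermitian.eq
    rwa [Matrix.conjTranspose_eq_transpose_of_trivial] at this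
  rw [Matrix.dotProduct_mulVec, ← Matrix.mulVec_transpose, hT, dotProduct_comm]

lemma aux_nonneg {N : ℕ} {A : Matrix (Fin N) (Fin N) ℝ} (hA : A.PosDef) (u : Fin N → ℝ) :
    0 ≤ u ⬝ᵥ (A *ᵥ u) := by
  have := hA.posSemidef.dotProduct_mulVec_nonneg u
  simpa using this

lemma aux_inv {N : ℕ} {A : Matrix (Fin N) (Fin N) ℝ} (hA : A.PosDef) (u : Fin N → ℝ) :
    A⁻¹ *ᵥ (A *ᵥ u) = u := by
  rw [Matrix.mulVec_mulVec, Matrix.nonsing_inv_mul _ ((Matrix.isUnit_iff_isUnit_det A).1 hA.isUnit),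
    Matrix.one_mulVec]

lemma aux_lower {N : ℕ} {A : Matrix (Fin N) (Fin N) ℝ} (hA : A.PosDef) (w : Fin N → ℝ) :
    w ⬝ᵥ w ≤ A.trace * (w ⬝ᵥ (A⁻¹ *ᵥ w)) := by
  have key : ∀ i, w i * w i ≤ A i i * (w ⬝ᵥ (A⁻¹ *ᵥ w)) := by
    intro i
    have hd : 0 < A i i := hA.diag_pos
    have h := aux_nonneg hA.inv (A i i • w - w i • (A *ᵥ Pi.single i 1))
    have h1 : (A *ᵥ Pi.single i 1) ⬝ᵥ (A⁻¹ *ᵥ w) = w i := by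
      rw [aux_symm hA.inv, aux_inv hA]; simp
    have h2 : (A *ᵥ Pi.single i (1:ℝ)) i = A i i := by simp
    simp only [Matrix.mulVec_sub, Matrix.mulVec_smul, aux_inv hA, sub_dotProduct, dotProduct_sub,
      smul_dotProduct, dotProduct_smul, h1, smul_eq_mul, dotProduct_single, Pi.sub_apply, Pi.smul_apply, h2, mul_one] at h
    have : 0 ≤ A i i * (A i i * (w ⬝ᵥ (A⁻¹ *ᵥ w)) - w i * w i) := by linarith
    have := nonneg_of_mul_nonneg_right this hd
    linarith
  rw [Matrix.trace, Finset.sum_mul]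
  exact Finset.sum_le_sum fun i _ => key i

lemma aux_gronwall {V V' : ℝ → ℝ} {κ δ : ℝ} (hκ : 0 < κ)
    (hV : ∀ t, 0 ≤ t → HasDerivAt V (V' t) t) (hle : ∀ t, 0 ≤ t → V' t ≤ -κ * V t + δ)
    (t : ℝ) (ht : 0 ≤ t) :
    V t ≤ V 0 * Real.exp (-κ * t) + δ / κ * (1 - Real.exp (-κ * t)) := by
  have hd : ∀ s, 0 ≤ s → HasDerivAt (fun s => (V s - δ / κ) * Real.exp (κ * s))
      (V' s * Real.exp (κ * s) + (V s - δ / κ) * (Real.exp (κ * s) * (κ * 1))) s := fun s hs =>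
    ((hV s hs).sub_const _).mul (((hasDerivAt_id s).const_mul κ).exp)
  have hanti : AntitoneOn (fun s => (V s - δ / κ) * Real.exp (κ * s)) (Set.Ici 0) := by
    apply antitoneOn_of_deriv_nonpos (convex_Ici 0)
    · exact fun s hs => (hd s hs).continuousAt.continuousWithinAt
    · intro s hs
      rw [interior_Ici] at hs
      exact (hd s (le_of_lt hs)).differentiableAt.differentiableWithinAt
    · intro s hs
      rw [interior_Ici] at hs
      rw [(hd s (le_of_lt hs)).deriv]
      have e : V' s * Real.exp (κ * s) + (V s - δ / κ) * (Real.exp (κ * s) * (κ * 1))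
          = (V' s + κ * V s - δ) * Real.exp (κ * s) := by field_simp; ring
      rw [e]
      exact mul_nonpos_of_nonpos_of_nonneg (by linarith [hle s (le_of_lt hs)]) (Real.exp_pos _).le
  have h := hanti (Set.mem_Ici.2 le_rfl) (Set.mem_Ici.2 ht) ht
  simp only [mul_zero, Real.exp_zero, mul_one] at h
  have h2 := mul_le_mul_of_nonneg_right h (Real.exp_pos (-κ * t)).le
  rw [mul_assoc, ← Real.exp_add] at h2
  have : κ * t + -κ * t = 0 := by ring
  rw [this, Real.exp_zero] at h2
  linarith

/-- Parts (i)-(ii) of Theorem 1 (adaptive dynamics identification): for the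
identifier error dynamics `x̃' = -a x̃ + W̃ᵀ S - ε`,
`W̃' = -σ Γ (W̃ + W*) - Γ x̃ S` with `Γ` symmetric positive definite satisfying
`vᵀ Γ⁻¹ v ≤ ‖v‖²/γ`, and `|ε| ≤ ε*`, the Lyapunov function
`V = ½ x̃² + ½ W̃ᵀ Γ⁻¹ W̃` satisfies
`V(t) ≤ V(0) e^{-κ t} + (δ/κ)(1 - e^{-κ t})` with `κ = min{a, σγ}` and
`δ = (ε*)²/(2a) + σ‖W*‖²/2`; hence all signals remain bounded and
`limsup_{t→∞} x̃(t)² ≤ 2δ/κ`. -/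
theorem identifier_signals_bounded_and_error_converges
    (N : ℕ) (hN : 0 < N)
    (Γ : Matrix (Fin N) (Fin N) ℝ) (hΓ : Γ.PosDef)
    (γ : ℝ) (hγ : 0 < γ)
    (hγΓ : ∀ v : Fin N → ℝ, v ⬝ᵥ (Γ⁻¹ *ᵥ v) ≤ (v ⬝ᵥ v) / γ)
    (a σ εstar : ℝ) (ha : 0 < a) (hσ : 0 < σ) (hεstar : 0 ≤ εstar)
    (Wstar : Fin N → ℝ) (S : ℝ → Fin N → ℝ) (ε : ℝ → ℝ)
    (hS : Continuous S) (hεc : Continuous ε)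
    (hε : ∀ t : ℝ, 0 ≤ t → |ε t| ≤ εstar)
    (x : ℝ → ℝ) (W : ℝ → Fin N → ℝ)
    (hx : ∀ t : ℝ, 0 ≤ t → HasDerivAt x (-a * x t + W t ⬝ᵥ S t - ε t) t)
    (hW : ∀ t : ℝ, 0 ≤ t →
      HasDerivAt W (-(σ • (Γ *ᵥ (W t + Wstar))) - x t • (Γ *ᵥ S t)) t) :
    (∀ t : ℝ, 0 ≤ t →
      (1 / 2) * (x t) ^ 2 + (1 / 2) * (W t ⬝ᵥ (Γ⁻¹ *ᵥ W t)) ≤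
        ((1 / 2) * (x 0) ^ 2 + (1 / 2) * (W 0 ⬝ᵥ (Γ⁻¹ *ᵥ W 0))) *
            Real.exp (-(min a (σ * γ)) * t) +
          ((εstar ^ 2 / (2 * a) + σ * (Wstar ⬝ᵥ Wstar) / 2) / min a (σ * γ)) *
            (1 - Real.exp (-(min a (σ * γ)) * t))) ∧
    (∃ M : ℝ, ∀ t : ℝ, 0 ≤ t →
      |x t| ≤ M ∧ Real.sqrt (W t ⬝ᵥ W t) ≤ M) ∧
    Filter.limsup (fun t => (x t) ^ 2) Filter.atTop ≤
      2 * (εstar ^ 2 / (2 * a) + σ * (Wstar ⬝ᵥ Wstar) / 2) / min a (σ * γ) := by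
  have hκ : 0 < min a (σ * γ) := lt_min ha (mul_pos hσ hγ)
  set κ := min a (σ * γ) with hκd
  set δ := εstar ^ 2 / (2 * a) + σ * (Wstar ⬝ᵥ Wstar) / 2 with hδd
  have hq : ∀ t, 0 ≤ W t ⬝ᵥ (Γ⁻¹ *ᵥ W t) := fun t => aux_nonneg hΓ.inv _
  have hself : ∀ v : Fin N → ℝ, 0 ≤ v ⬝ᵥ v := fun v =>
    Finset.sum_nonneg fun i _ => mul_self_nonneg (v i)
  have hδ : 0 ≤ δ := by have := hself Wstar; positivity
  have main : ∀ t : ℝ, 0 ≤ t →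
      (1 / 2) * (x t) ^ 2 + (1 / 2) * (W t ⬝ᵥ (Γ⁻¹ *ᵥ W t)) ≤
        ((1 / 2) * (x 0) ^ 2 + (1 / 2) * (W 0 ⬝ᵥ (Γ⁻¹ *ᵥ W 0))) * Real.exp (-κ * t) +
          δ / κ * (1 - Real.exp (-κ * t)) := by
    refine aux_gronwall (V := fun t => (1 / 2) * (x t) ^ 2 + (1 / 2) * (W t ⬝ᵥ (Γ⁻¹ *ᵥ W t)))
      (V' := fun t => -a * x t ^ 2 - x t * ε t - σ * (W t ⬝ᵥ W t) - σ * (W t ⬝ᵥ Wstar)) hκ ?_ ?_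
    · intro t ht
      have h1 := ((hx t ht).pow 2).const_mul (1 / 2 : ℝ)
      have h2 := (aux_hasDerivAt_dot (hW t ht)
        (aux_hasDerivAt_mulVec Γ⁻¹ (hW t ht))).const_mul (1 / 2 : ℝ)
      refine (h1.add h2).congr_deriv ?_
      rw [aux_symm hΓ.inv _ (W t)]
      simp only [Matrix.mulVec_sub, Matrix.mulVec_neg, Matrix.mulVec_smul, aux_inv hΓ,
        dotProduct_sub, dotProduct_neg, dotProduct_smul, dotProduct_add, smul_eq_mul]
      norm_num
      ring
    · intro t ht
      have hy1 : -(x t * ε t) ≤ a / 2 * x t ^ 2 + εstar ^ 2 / (2 * a) := by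
        have e1 : ε t ^ 2 ≤ εstar ^ 2 := sq_le_sq' (abs_le.1 (hε t ht)).1 (abs_le.1 (hε t ht)).2
        have e2 : ε t ^ 2 / (2 * a) ≤ εstar ^ 2 / (2 * a) := by gcongr
        have e3 : a / 2 * x t ^ 2 + ε t ^ 2 / (2 * a) + x t * ε t
            = (a * x t + ε t) ^ 2 / (2 * a) := by field_simp; ring
        have e4 : 0 ≤ (a * x t + ε t) ^ 2 / (2 * a) := by positivity
        linarith
      have hy2 : 0 ≤ W t ⬝ᵥ W t + 2 * (W t ⬝ᵥ Wstar) + Wstar ⬝ᵥ Wstar := by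
        have := hself (W t + Wstar)
        simp only [add_dotProduct, dotProduct_add, dotProduct_comm Wstar (W t)] at this
        linarith
      have hy3 := mul_nonneg hσ.le hy2
      have hy4 : γ * (W t ⬝ᵥ (Γ⁻¹ *ᵥ W t)) ≤ W t ⬝ᵥ W t := by
        have := (le_div_iff₀ hγ).1 (hγΓ (W t)); linarith
      have hy5 := mul_le_mul_of_nonneg_left hy4 hσ.le
      have hy6 := mul_le_mul_of_nonneg_right (min_le_right a (σ * γ)) (hq t)
      have hy7 := mul_le_mul_of_nonneg_right (min_le_left a (σ * γ)) (sq_nonneg (x t))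
      rw [← hκd] at hy6 hy7
      simp only [hδd]
      linarith
  have hxV : ∀ t, 0 ≤ t → x t ^ 2 ≤ 2 * (((1 / 2) * (x 0) ^ 2 +
      (1 / 2) * (W 0 ⬝ᵥ (Γ⁻¹ *ᵥ W 0))) * Real.exp (-κ * t) +
          δ / κ * (1 - Real.exp (-κ * t))) := fun t ht => by
    linarith [main t ht, hq t]
  refine ⟨main, ?_, ?_⟩
  · set V0 := (1 / 2) * (x 0) ^ 2 + (1 / 2) * (W 0 ⬝ᵥ (Γ⁻¹ *ᵥ W 0)) with hV0d
    have hV0 : 0 ≤ V0 := by have := hq 0; positivity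
    have hb : ∀ t, 0 ≤ t → V0 * Real.exp (-κ * t) + δ / κ * (1 - Real.exp (-κ * t))
        ≤ V0 + δ / κ := by
      intro t ht
      have h1 : Real.exp (-κ * t) ≤ 1 := Real.exp_le_one_iff.2 (by nlinarith)
      have h2 := Real.exp_pos (-κ * t)
      have h3 : 0 ≤ δ / κ := by positivity
      nlinarith
    have htr : 0 ≤ Γ.trace := Finset.sum_nonneg fun i _ => (hΓ.diag_pos (i := i)).le
    refine ⟨max (Real.sqrt (2 * (V0 + δ / κ))) (Real.sqrt (Γ.trace * (2 * (V0 + δ / κ)))),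
      fun t ht => ⟨le_max_of_le_left ?_, le_max_of_le_right ?_⟩⟩
    · apply Real.abs_le_sqrt
      linarith [hxV t ht, hb t ht]
    · apply Real.sqrt_le_sqrt
      refine (aux_lower hΓ (W t)).trans (mul_le_mul_of_nonneg_left ?_ htr)
      linarith [main t ht, hb t ht, sq_nonneg (x t)]
  · have he : Filter.Tendsto (fun t : ℝ => Real.exp (-κ * t)) Filter.atTop (nhds 0) :=
      Real.tendsto_exp_atBot.comp
        (Filter.tendsto_id.const_mul_atTop_of_neg (neg_lt_zero.2 hκ))
    have hT := ((he.const_mul ((1 / 2) * (x 0) ^ 2 + (1 / 2) * (W 0 ⬝ᵥ (Γ⁻¹ *ᵥ W 0)))).add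
      ((he.const_sub 1).const_mul (δ / κ))).const_mul 2
    have hle := Filter.limsup_le_limsup (f := Filter.atTop)
      (Filter.eventually_atTop.2 ⟨0, hxV⟩)
      (Filter.isCoboundedUnder_le_of_le Filter.atTop (x := 0) fun t => sq_nonneg (x t))
      hT.isBoundedUnder_le
    rw [hT.limsup_eq] at hle
    refine hle.trans (le_of_eq ?_)
    ring
end
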